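/- arXiv:1011.0323 — 6 statements merged into one kernel-verified Lean document; each statement's English description precedes it below -/
import Mathlib

section
/- Σ over integers m,n ≥ 1 with m odd of 1/(m²·n⁴·(m+n)⁴·(m+2n)²) = (29/3832012800)·π¹². -/
theorem b8 : bernoulli 4 = -1/30 ∧ bernoulli 6 = 1/42 ∧ bernoulli 8 = -1/30 ∧ bernoulli 10 = 5/66 ∧ bernoulli 12 = -691/2730 := by
  have o5 : bernoulli' 5 = 0 := bernoulli'_eq_zero_of_odd (by decide) (by norm_num)
  have o7 : bernoulli' 7 = 0 := bernoulli'_eq_zero_of_odd (by decide) (by norm_num)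
  have o9 : bernoulli' 9 = 0 := bernoulli'_eq_zero_of_odd (by decide) (by norm_num)
  have o11 : bernoulli' 11 = 0 := bernoulli'_eq_zero_of_odd (by decide) (by norm_num)
  have e6 : bernoulli' 6 = 1/42 := by
    rw [bernoulli'_def]; norm_num [Finset.sum_range_succ, o5, Nat.choose]
  have e8 : bernoulli' 8 = -1/30 := by
    rw [bernoulli'_def]; norm_num [Finset.sum_range_succ, o5, o7, e6, Nat.choose]
  have e10 : bernoulli' 10 = 5/66 := by
    rw [bernoulli'_def]; norm_num [Finset.sum_range_succ, o5, o7, o9, e6, e8, Nat.choose]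
  have e12 : bernoulli' 12 = -691/2730 := by
    rw [bernoulli'_def]; norm_num [Finset.sum_range_succ, o5, o7, o9, o11, e6, e8, e10, Nat.choose]
  simp [bernoulli, e6, e8, e10, e12]
  norm_num

theorem hcg {f g : ℕ → ℝ} {a b : ℝ} (h : HasSum f a) (h1 : ∀ k, g k = f k) (h2 : b = a) :
    HasSum g b := by
  have : g = f := funext h1
  rw [this, h2]; exact h

theorem scg {f g : ℕ → ℝ} (h : Summable f) (h1 : ∀ k, g k = f k) : Summable g := by
  have : g = f := funext h1
  rw [this]; exact h

theorem evenSum {s : ℕ} (hs : s ≠ 0) {Z : ℝ} (h : HasSum (fun n : ℕ => 1 / (n : ℝ) ^ s) Z) :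
    HasSum (fun k : ℕ => 1 / (2 * (k : ℝ) + 2) ^ s) (Z / 2 ^ s) := by
  have h1 : HasSum (fun n : ℕ => 1 / ((n + 1 : ℕ) : ℝ) ^ s) Z := by
    rw [hasSum_nat_add_iff (f := fun n : ℕ => 1 / (n : ℝ) ^ s) 1]
    simpa [hs] using h
  have h2 := h1.mul_right (1 / (2 : ℝ) ^ s)
  refine hcg h2 ?_ ?_
  · intro k
    push_cast
    rw [show 2 * (k : ℝ) + 2 = (k + 1) * 2 by ring, mul_pow]
    field_simp
  · ring

theorem oddSum {s : ℕ} (hs : s ≠ 0) {Z : ℝ} (h : HasSum (fun n : ℕ => 1 / (n : ℝ) ^ s) Z) :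
    HasSum (fun k : ℕ => 1 / (2 * (k : ℝ) + 1) ^ s) (Z - Z / 2 ^ s) := by
  have h1 : HasSum (fun n : ℕ => 1 / ((n + 1 : ℕ) : ℝ) ^ s) Z := by
    rw [hasSum_nat_add_iff (f := fun n : ℕ => 1 / (n : ℝ) ^ s) 1]
    simpa [hs] using h
  have he := evenSum hs h
  have hinj : Function.Injective (fun k : ℕ => 2 * k) := fun a b hab => by simpa using hab
  have ho := (h1.summable.comp_injective hinj).hasSum
  have he' : HasSum (fun k : ℕ => 1 / ((2 * k + 1 + 1 : ℕ) : ℝ) ^ s) (Z / 2 ^ s) := by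
    refine hcg he (fun k => ?_) rfl
    push_cast; ring_nf
  have key := HasSum.even_add_odd (f := fun n : ℕ => 1 / ((n + 1 : ℕ) : ℝ) ^ s) ho he'
  have := key.unique h1
  have e : Z - Z / 2 ^ s = ∑' b, ((fun n : ℕ => 1 / ((n + 1 : ℕ) : ℝ) ^ s) ∘ fun k : ℕ => 2 * k) b := by
    linarith
  rw [e]
  refine hcg ho (fun k => ?_) rfl
  simp

theorem ne1 (k j : ℕ) : (2 * (k : ℝ) + 1 - 2 * j) ≠ 0 := by
  intro h
  have : (2 * (k : ℤ) + 1 - 2 * j) = 0 := by exact_mod_cast h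
  omega

theorem sqSum1 (j : ℕ) : Summable (fun k : ℕ => 1 / (2 * (k : ℝ) + 1 - 2 * j) ^ 2) ∧
    Summable (fun k : ℕ => 1 / (2 * (k : ℝ) + 3 + 2 * j) ^ 2) ∧
    HasSum (fun k : ℕ => 1 / (2 * (k : ℝ) + 1 - 2 * j) ^ 2 + 1 / (2 * (k : ℝ) + 3 + 2 * j) ^ 2)
      (Real.pi ^ 2 / 4 - 1 / (2 * (j : ℝ) + 1) ^ 2) := by
  have h0 := oddSum two_ne_zero hasSum_zeta_two
  induction j with
  | zero =>
    have h3 : HasSum (fun k : ℕ => 1 / (2 * (k : ℝ) + 3) ^ 2)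
        (Real.pi ^ 2 / 6 - Real.pi ^ 2 / 6 / 2 ^ 2 - 1) := by
      have := (hasSum_nat_add_iff (f := fun k : ℕ => 1 / (2 * (k : ℝ) + 1) ^ 2)
        (g := Real.pi ^ 2 / 6 - Real.pi ^ 2 / 6 / 2 ^ 2 - 1) 1).2 (by simpa using h0)
      refine hcg this (fun k => ?_) rfl
      push_cast; ring_nf
    refine ⟨by simpa using h0.summable, by simpa using h3.summable, ?_⟩
    refine hcg (h0.add h3) ?_ ?_
    · intro k; simp
    · simp; ring
  | succ j ih =>
    obtain ⟨s1, s2, s3⟩ := ih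
    have hp : HasSum (fun k : ℕ => 1 / (2 * (k : ℝ) + 1 - 2 * (j + 1 : ℕ)) ^ 2)
        ((∑' k : ℕ, 1 / (2 * (k : ℝ) + 1 - 2 * j) ^ 2) + 1 / (2 * (j : ℝ) + 1) ^ 2) := by
      have := (hasSum_nat_add_iff (f := fun k : ℕ => 1 / (2 * (k : ℝ) + 1 - 2 * (j + 1 : ℕ)) ^ 2)
        (g := ∑' k : ℕ, 1 / (2 * (k : ℝ) + 1 - 2 * j) ^ 2) 1).1 (by
          refine hcg s1.hasSum (fun k => ?_) rfl
          push_cast; ring_nf)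
      refine hcg this (fun k => rfl) ?_
      simp
      rw [← neg_sq]; ring_nf
    have hq : HasSum (fun k : ℕ => 1 / (2 * (k : ℝ) + 3 + 2 * (j + 1 : ℕ)) ^ 2)
        ((∑' k : ℕ, 1 / (2 * (k : ℝ) + 3 + 2 * j) ^ 2) - 1 / (2 * (j : ℝ) + 3) ^ 2) := by
      have := (hasSum_nat_add_iff (f := fun k : ℕ => 1 / (2 * (k : ℝ) + 3 + 2 * j) ^ 2)
        (g := (∑' k : ℕ, 1 / (2 * (k : ℝ) + 3 + 2 * j) ^ 2) - 1 / (2 * (j : ℝ) + 3) ^ 2) 1).2 (by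
          refine hcg s2.hasSum (fun k => rfl) ?_
          simp only [Finset.sum_range_one, Nat.cast_zero, mul_zero, zero_add]
          rw [add_comm (2 * (j : ℝ)) 3]
          ring)
      refine hcg this (fun k => ?_) rfl
      push_cast; ring_nf
    refine ⟨hp.summable, hq.summable, ?_⟩
    have h4 := (s1.hasSum.add s2.hasSum).unique s3
    refine hcg (hp.add hq) (fun k => rfl) ?_
    push_cast
    have : 2 * ((j : ℝ) + 1) + 1 = 2 * j + 3 := by ring
    rw [this]
    linarith

theorem tele (j : ℤ) (hs : Summable fun k : ℕ => 1 / (2 * (k : ℝ) + 1 + 2 * j)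
      - 1 / (2 * (k : ℝ) + 3 + 2 * j)) :
    HasSum (fun k : ℕ => 1 / (2 * (k : ℝ) + 1 + 2 * j) - 1 / (2 * (k : ℝ) + 3 + 2 * j))
      (1 / (1 + 2 * (j : ℝ))) := by
  rw [hs.hasSum_iff_tendsto_nat]
  have e : ∀ n : ℕ, ∑ k ∈ Finset.range n, (1 / (2 * (k : ℝ) + 1 + 2 * j) - 1 / (2 * (k : ℝ) + 3 + 2 * j))
      = 1 / (1 + 2 * (j : ℝ)) - 1 / (2 * (n : ℝ) + 1 + 2 * j) := by
    intro n
    have := Finset.sum_range_sub' (fun k : ℕ => 1 / (2 * (k : ℝ) + 1 + 2 * j)) n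
    simp only [Nat.cast_zero, mul_zero, zero_add] at this
    rw [← this]
    refine Finset.sum_congr rfl fun k _ => ?_
    push_cast; ring_nf
  simp_rw [e]
  have h1 : Filter.Tendsto (fun n : ℕ => 2 * (n : ℝ) + 1 + 2 * j) Filter.atTop Filter.atTop := by
    apply Filter.tendsto_atTop_add_const_right
    apply Filter.tendsto_atTop_add_const_right
    exact tendsto_natCast_atTop_atTop.const_mul_atTop two_pos
  have h2 := h1.inv_tendsto_atTop
  simpa [one_div] using h2.const_sub (1 / (1 + 2 * (j : ℝ)))

theorem prodSummable {f g : ℕ → ℝ} (hf : Summable fun k => f k ^ 2) (hg : Summable fun k => g k ^ 2) :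
    Summable fun k => f k * g k := by
  refine Summable.of_norm_bounded (hf.add hg) fun k => ?_
  rw [Real.norm_eq_abs, abs_le]
  constructor <;> nlinarith [sq_nonneg (f k + g k), sq_nonneg (f k - g k)]

theorem dSum (j : ℕ) :
    HasSum (fun k : ℕ => 1 / (2 * (k : ℝ) + 1 - 2 * j) - 1 / (2 * (k : ℝ) + 3 + 2 * j))
      (1 / (2 * (j : ℝ) + 1)) := by
  induction j with
  | zero =>
    have := tele 0 (by
      have h := prodSummable (f := fun k : ℕ => 1 / (2 * (k : ℝ) + 1 - 2 * (0 : ℕ)))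
        (g := fun k : ℕ => 1 / (2 * (k : ℝ) + 3 + 2 * (0 : ℕ)))
        (by simpa using (sqSum1 0).1) (by simpa using (sqSum1 0).2.1)
      refine scg (h.mul_left 2) (fun k => ?_)
      have : 2 * (k : ℝ) + 1 ≠ 0 := by positivity
      have : 2 * (k : ℝ) + 3 ≠ 0 := by positivity
      simp
      field_simp
      ring)
    simpa using this
  | succ j ih =>
    have t1 := tele (-(j + 1 : ℕ)) (by
      have h := prodSummable (f := fun k : ℕ => 1 / (2 * (k : ℝ) + 1 - 2 * (j + 1 : ℕ)))
        (g := fun k : ℕ => 1 / (2 * (k : ℝ) + 1 - 2 * j))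
        (by simpa only [one_div, inv_pow] using (sqSum1 (j + 1)).1)
        (by simpa only [one_div, inv_pow] using (sqSum1 j).1)
      refine scg (h.mul_left 2) (fun k => ?_)
      have h1 := ne1 k (j + 1)
      have h2 := ne1 k j
      have e1 : 2 * (k : ℝ) + 1 + 2 * ((-((j + 1 : ℕ) : ℤ) : ℤ) : ℝ)
        = 2 * (k : ℝ) + 1 - 2 * (j + 1 : ℕ) := by push_cast; ring
      have e2 : 2 * (k : ℝ) + 3 + 2 * ((-((j + 1 : ℕ) : ℤ) : ℤ) : ℝ)
        = 2 * (k : ℝ) + 1 - 2 * j := by push_cast; ring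
      rw [e1, e2]
      field_simp
      push_cast
      ring)
    have t2 := tele (j + 1 : ℕ) (by
      have h := prodSummable (f := fun k : ℕ => 1 / (2 * (k : ℝ) + 3 + 2 * j))
        (g := fun k : ℕ => 1 / (2 * (k : ℝ) + 3 + 2 * (j + 1 : ℕ)))
        (by simpa only [one_div, inv_pow] using (sqSum1 j).2.1)
        (by simpa only [one_div, inv_pow] using (sqSum1 (j + 1)).2.1)
      refine scg (h.mul_left 2) (fun k => ?_)
      have h1 : 2 * (k : ℝ) + 3 + 2 * j ≠ 0 := by positivity
      have h2 : 2 * (k : ℝ) + 3 + 2 * (j + 1 : ℕ) ≠ 0 := by positivity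
      have e1 : 2 * (k : ℝ) + 1 + 2 * (((j + 1 : ℕ) : ℤ) : ℝ)
        = 2 * (k : ℝ) + 3 + 2 * j := by push_cast; ring
      have e2 : 2 * (k : ℝ) + 3 + 2 * (((j + 1 : ℕ) : ℤ) : ℝ)
        = 2 * (k : ℝ) + 3 + 2 * (j + 1 : ℕ) := by push_cast; ring
      rw [e1, e2]
      field_simp
      push_cast
      ring)
    refine hcg ((ih.add t1).add t2) ?_ ?_
    · intro k
      push_cast
      ring_nf
    · push_cast
      have h1 : 2 * (j : ℝ) + 1 ≠ 0 := by positivity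
      have h2 : 1 + 2 * ((j : ℝ) + 1) ≠ 0 := by positivity
      have h4 : 2 * ((j : ℝ) + 1) + 1 ≠ 0 := by positivity
      have e : 1 + 2 * (-1 + -(j : ℝ)) = -(2 * j + 1) := by ring
      have e' : 1 + 2 * (-((j : ℝ) + 1)) = -(2 * j + 1) := by ring
      simp only [e, e']
      rw [one_div_neg_eq_neg_one_div]
      field_simp
      ring

theorem inner (j : ℕ) :
    HasSum (fun k : ℕ => 1 / ((2 * (k : ℝ) + 2) ^ 4 * (2 * (j : ℝ) + 1) ^ 4 *
        ((2 * (k : ℝ) + 2) ^ 2 - (2 * (j : ℝ) + 1) ^ 2) ^ 2))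
      (Real.pi ^ 4 / 1440 * (1 / (2 * (j : ℝ) + 1) ^ 8)
        + 7 * Real.pi ^ 2 / 48 * (1 / (2 * (j : ℝ) + 1) ^ 10)
        - 3 / 2 * (1 / (2 * (j : ℝ) + 1) ^ 12)) := by
  have z2 := evenSum two_ne_zero hasSum_zeta_two
  have z4 := evenSum four_ne_zero hasSum_zeta_four
  have a := (sqSum1 j).2.2
  have d := dSum j
  set b : ℝ := 2 * (j : ℝ) + 1 with hb
  have b0 : b ≠ 0 := by positivity
  refine hcg ((((a.sub (d.mul_left (1 / b))).mul_left (1 / (4 * b ^ 10))).add (z4.mul_left (1 / b ^ 8))).sub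
    (((d.mul_left (1 / (2 * b))).sub z2).mul_left (2 / b ^ 10))) ?_ ?_
  · intro k
    have n1 := ne1 k j
    have e1 : 2 * (k : ℝ) + 1 - 2 * j = (2 * k + 2) - b := by rw [hb]; ring
    have e2 : 2 * (k : ℝ) + 3 + 2 * j = (2 * k + 2) + b := by rw [hb]; ring
    have n2 : 2 * (k : ℝ) + 3 + 2 * j ≠ 0 := by positivity
    have n3 : 2 * (k : ℝ) + 2 ≠ 0 := by positivity
    rw [e1] at n1
    rw [e2] at n2
    simp only [e1, e2]
    generalize 2 * (k : ℝ) + 2 = A at *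
    rw [show A ^ 2 - b ^ 2 = (A - b) * (A + b) by ring]
    field_simp
    ring
  · field_simp
    ring

theorem bij : (∑' pr : ℕ × ℕ, (if (pr.1 + 1) % 2 = 1 then
      (1 : ℝ) / (((pr.1 : ℝ) + 1) ^ 2 * ((pr.2 : ℝ) + 1) ^ 4
        * ((pr.1 : ℝ) + (pr.2 : ℝ) + 2) ^ 4
        * ((pr.1 : ℝ) + 2 * (pr.2 : ℝ) + 3) ^ 2) else 0))
    = ∑' p : ℕ × ℕ, 1 / ((2 * (p.2 : ℝ) + 2) ^ 4 * (2 * (p.1 : ℝ) + 1) ^ 4 *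
        ((2 * (p.2 : ℝ) + 2) ^ 2 - (2 * (p.1 : ℝ) + 1) ^ 2) ^ 2) := by
  set g : ℕ × ℕ → ℕ × ℕ := fun p => if p.2 < p.1 then (2 * (p.1 - p.2 - 1), 2 * p.2 + 1)
    else (2 * (p.2 - p.1), 2 * p.1) with hg
  have hinj : Function.Injective g := by
    rintro ⟨j, k⟩ ⟨j', k'⟩ h
    simp only [hg] at h
    split_ifs at h <;> simp only [Prod.mk.injEq] at h ⊢ <;> omega
  rw [← hinj.tsum_eq]
  · refine tsum_congr ?_
    rintro ⟨j, k⟩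
    by_cases h1 : k < j
    · have e : g (j, k) = (2 * (j - k - 1), 2 * k + 1) := by simp [hg, h1]
      rw [e]
      obtain ⟨d, rfl⟩ := Nat.exists_eq_add_of_lt h1
      have : k + d + 1 - k - 1 = d := by omega
      simp only [this]
      rw [if_pos (by omega)]
      push_cast
      congr 1
      ring
    · have e : g (j, k) = (2 * (k - j), 2 * j) := by simp [hg, h1]
      rw [e]
      obtain ⟨d, rfl⟩ := Nat.exists_eq_add_of_le (not_lt.1 h1)
      have : j + d - j = d := by omega
      simp only [this]
      rw [if_pos (by omega)]
      push_cast
      congr 1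
      ring
  · rintro ⟨x, y⟩ h
    have hx : (x + 1) % 2 = 1 := by
      by_contra hne
      simp [hne] at h
    rcases Nat.even_or_odd' y with ⟨c, rfl | rfl⟩
    · refine ⟨(c, c + x / 2), ?_⟩
      simp only [hg]
      rw [if_neg (by omega)]
      refine Prod.ext ?_ ?_ <;> dsimp only <;> omega
    · refine ⟨(c + x / 2 + 1, c), ?_⟩
      simp only [hg]
      rw [if_pos (by omega)]
      refine Prod.ext ?_ ?_ <;> dsimp only <;> omega

/-- The value ζ₂PSp2(2,4,4,2): the sum over m,n ≥ 1 with m odd of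
1/(m²n⁴(m+n)⁴(m+2n)²) equals (29/3832012800)π¹². -/
theorem zeta2_PSp2_two_four_four_two :
    (∑' pr : ℕ × ℕ, (if (pr.1 + 1) % 2 = 1 then
      (1 : ℝ) / (((pr.1 : ℝ) + 1) ^ 2 * ((pr.2 : ℝ) + 1) ^ 4
        * ((pr.1 : ℝ) + (pr.2 : ℝ) + 2) ^ 4
        * ((pr.1 : ℝ) + 2 * (pr.2 : ℝ) + 3) ^ 2) else 0))
    = 29 / 3832012800 * Real.pi ^ 12 := by
  rw [bij]
  obtain ⟨-, -, b8, b10, b12⟩ := b8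
  have l8 := oddSum (by norm_num) (hasSum_zeta_nat (k := 4) (by norm_num))
  have l10 := oddSum (by norm_num) (hasSum_zeta_nat (k := 5) (by norm_num))
  have l12 := oddSum (by norm_num) (hasSum_zeta_nat (k := 6) (by norm_num))
  norm_num only [b8, b10, b12, Nat.factorial] at l8 l10 l12
  have tot := ((l8.mul_left (Real.pi ^ 4 / 1440)).add (l10.mul_left (7 * Real.pi ^ 2 / 48))).sub
    (l12.mul_left (3 / 2))
  have hn : (0 : ℕ × ℕ → ℝ) ≤ fun p : ℕ × ℕ => 1 / ((2 * (p.2 : ℝ) + 2) ^ 4 * (2 * (p.1 : ℝ) + 1) ^ 4 *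
        ((2 * (p.2 : ℝ) + 2) ^ 2 - (2 * (p.1 : ℝ) + 1) ^ 2) ^ 2) := by
    intro p
    simp only [Pi.zero_apply]
    positivity
  have hsum := (summable_prod_of_nonneg hn).2 ⟨fun j => (inner j).summable, by
    simp only [fun j => (inner j).tsum_eq]
    exact tot.summable⟩
  rw [hsum.tsum_prod' fun j => (inner j).summable]
  simp only [fun j => (inner j).tsum_eq]
  rw [tot.tsum_eq]
  ring
end

section
/- Σ over integers m,n ≥ 1 with m odd of 1/(m⁴·n⁴·(m+n)⁴·(m+2n)⁴) = (479/55794106368000)·π¹⁶. -/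
open Filter Topology

lemma even_sum (F : ℤ → ℝ) (h0 : F 0 = 0) (he : ∀ n, F (-n) = F n) (Z : ℝ)
    (hZ : HasSum (fun n : ℕ => F n) Z) (p : ℕ) :
    HasSum (fun k : ℕ => F (k - p) + F (k + p + 1)) (2 * Z) := by
  have A : ∀ p : ℕ, HasSum (fun k : ℕ => F ((k:ℤ) - p)) (Z + ∑ i ∈ Finset.range p, F (i + 1)) := by
    intro p
    induction p with
    | zero => simpa using hZ
    | succ p ih =>
      rw [← hasSum_nat_add_iff' 1]
      convert! ih using 1
      · funext k; congr 1; push_cast; ring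
      · rw [Finset.sum_range_succ, Finset.sum_range_one, ← he ((p:ℤ) + 1)]
        push_cast
        rw [zero_sub]; ring
  have B : HasSum (fun k : ℕ => F ((k:ℤ) + p + 1)) (Z - ∑ i ∈ Finset.range p, F (i + 1)) := by
    have := (hasSum_nat_add_iff' (p + 1)).2 hZ
    convert! this using 1
    · rw [Finset.sum_range_succ']; push_cast; rw [h0]; ring
  convert! (A p).add B using 1
  ring

lemma odd_sum (F : ℤ → ℝ) (ho : ∀ n, F (-n) = - F n) 
    (hm : ∀ m n : ℤ, 0 < m → m ≤ n → F n ≤ F m)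
    (hF : Tendsto (fun n : ℕ => F n) atTop (𝓝 0)) (p : ℕ) :
    HasSum (fun k : ℕ => F (k - p) - F (k + p + 1)) 0 := by
  have h0 : F 0 = 0 := by have := ho 0; simp at this; linarith
  have T : Tendsto (fun N : ℕ => ∑ k ∈ Finset.range N, (F ((k:ℤ) - p) - F (k + p + 1))) atTop (𝓝 0) := by
    induction p with
    | zero =>
      have : ∀ N : ℕ, ∑ k ∈ Finset.range N, (F ((k:ℤ) - (0:ℕ)) - F (k + (0:ℕ) + 1)) = - F N := by
        intro N
        induction N with
        | zero => simp [h0]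
        | succ n ih => rw [Finset.sum_range_succ, ih]; push_cast; simp only [add_zero, sub_zero]; ring
      simp only [this]
      simpa using hF.neg
    | succ p ih =>
      have : ∀ N : ℕ, ∑ k ∈ Finset.range N, (F ((k:ℤ) - (p+1:ℕ)) - F (k + (p+1:ℕ) + 1)) =
          ∑ k ∈ Finset.range N, (F ((k:ℤ) - p) - F (k + p + 1)) - (F ((N:ℤ) - p - 1) + F (N + p + 1)) := by
        intro N
        induction N with
        | zero => 
          have := ho (p + 1)
          simp only [Finset.range_zero, Finset.sum_empty]
          push_cast
          rw [show (0:ℤ) - p - 1 = -(p+1) by ring, this]; simp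
        | succ n ih => 
          rw [Finset.sum_range_succ, ih, Finset.sum_range_succ]; push_cast
          rw [show (n:ℤ) - (p+1) = n - p - 1 by ring, show (n:ℤ) + (p+1) + 1= n + 1 + p + 1 by ring,
            show (n:ℤ) + 1 - p - 1 = n - p by ring]
          ring
      simp only [this]
      have e1 : Tendsto (fun N : ℕ => F ((N:ℤ) + p + 1)) atTop (𝓝 0) := by
        refine ((tendsto_add_atTop_iff_nat (p+1)).2 hF).congr ?_
        intro N; congr 1
      have e2 : Tendsto (fun N : ℕ => F ((N:ℤ) - p - 1)) atTop (𝓝 0) := by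
        refine (tendsto_add_atTop_iff_nat (p+1)).1 (hF.congr ?_)
        intro N; congr 1; push_cast; ring_nf
      simpa using ih.sub (e2.add e1)
  rw [← hasSum_nat_add_iff' (p+1), hasSum_iff_tendsto_nat_of_nonneg]
  · have := ((tendsto_add_atTop_iff_nat (p+1)).2 T).sub_const (∑ k ∈ Finset.range (p+1), (F ((k:ℤ) - p) - F (k + p + 1)))
    refine this.congr ?_
    intro N
    rw [add_comm N, Finset.sum_range_add, add_sub_cancel_left]
    refine Finset.sum_congr rfl fun k _ => ?_
    rw [add_comm (p+1) k]
  · intro k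
    have := hm (((k + (p+1) : ℕ) : ℤ) - p) (((k + (p+1) : ℕ) : ℤ) + p + 1) (by push_cast; omega) (by omega)
    linarith

lemma bern12 : bernoulli 12 = -691/2730 ∧ bernoulli 14 = 7/6 ∧ bernoulli 16 = -3617/510 := by
  have b5 : bernoulli' 5 = 0 := bernoulli'_eq_zero_of_odd (by decide) (by norm_num)
  have b7 : bernoulli' 7 = 0 := bernoulli'_eq_zero_of_odd (by decide) (by norm_num)
  have b9 : bernoulli' 9 = 0 := bernoulli'_eq_zero_of_odd (by decide) (by norm_num)
  have b11 : bernoulli' 11 = 0 := bernoulli'_eq_zero_of_odd (by decide) (by norm_num)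
  have b13 : bernoulli' 13 = 0 := bernoulli'_eq_zero_of_odd (by decide) (by norm_num)
  have b15 : bernoulli' 15 = 0 := bernoulli'_eq_zero_of_odd (by decide) (by norm_num)
  have b6 : bernoulli' 6 = 1/42 := by
    rw [bernoulli'_def]; norm_num [Finset.sum_range_succ, Nat.choose, *]
  have b8 : bernoulli' 8 = -1/30 := by
    rw [bernoulli'_def]; norm_num [Finset.sum_range_succ, Nat.choose, *]
  have b10 : bernoulli' 10 = 5/66 := by
    rw [bernoulli'_def]; norm_num [Finset.sum_range_succ, Nat.choose, *]
  have b12 : bernoulli' 12 = -691/2730 := by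
    rw [bernoulli'_def]; norm_num [Finset.sum_range_succ, Nat.choose, *]
  have b14 : bernoulli' 14 = 7/6 := by
    rw [bernoulli'_def]; norm_num [Finset.sum_range_succ, Nat.choose, *]
  have b16 : bernoulli' 16 = -3617/510 := by
    rw [bernoulli'_def]; norm_num [Finset.sum_range_succ, Nat.choose, *]
  refine ⟨?_, ?_, ?_⟩ <;> rw [bernoulli_eq_bernoulli'_of_ne_one (by norm_num)] <;> assumption

lemma odd_zeta (s : ℕ) (hs : s ≠ 0) (Z : ℝ) (h : HasSum (fun n : ℕ => 1 / (n : ℝ) ^ s) Z) :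
    HasSum (fun n : ℕ => 1 / (2 * (n : ℝ) + 1) ^ s) ((1 - 1 / 2 ^ s) * Z) := by
  have he : HasSum (fun n : ℕ => 1 / ((2 * n : ℕ) : ℝ) ^ s) (1 / 2 ^ s * Z) := by
    convert! h.mul_left (1 / 2 ^ s : ℝ) using 1
    funext n; push_cast; rw [mul_pow]; ring
  have hsum : Summable (fun n : ℕ => 1 / ((2 * n + 1 : ℕ) : ℝ) ^ s) :=
    h.summable.comp_injective (i := fun n => 2 * n + 1) (fun a b hab => by simpa using hab)
  have := HasSum.even_add_odd (f := fun n : ℕ => 1 / (n : ℝ) ^ s) he hsum.hasSum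
  have e := this.unique h
  have h3 := hsum.hasSum
  rw [show (∑' n : ℕ, 1 / ((2 * n + 1 : ℕ) : ℝ) ^ s) = (1 - 1/2^s) * Z by linarith] at h3
  simpa using h3

lemma z2 : HasSum (fun n : ℕ => 1 / (2 * (n : ℝ) + 1) ^ 2) (Real.pi ^ 2 / 8) := by
  convert! odd_zeta 2 (by norm_num) _ hasSum_zeta_two using 1; ring
lemma z4 : HasSum (fun n : ℕ => 1 / (2 * (n : ℝ) + 1) ^ 4) (Real.pi ^ 4 / 96) := by
  convert! odd_zeta 4 (by norm_num) _ hasSum_zeta_four using 1; ring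
lemma z12 : HasSum (fun n : ℕ => 1 / (2 * (n : ℝ) + 1) ^ 12) (691 / 638668800 * Real.pi ^ 12) := by
  have := hasSum_zeta_nat (k := 6) (by norm_num)
  convert! odd_zeta 12 (by norm_num) _ this using 1
  norm_num [bern12.1, Nat.factorial]; ring
lemma z14 : HasSum (fun n : ℕ => 1 / (2 * (n : ℝ) + 1) ^ 14) (5461 / 49816166400 * Real.pi ^ 14) := by
  have := hasSum_zeta_nat (k := 7) (by norm_num)
  convert! odd_zeta 14 (by norm_num) _ this using 1
  norm_num [bern12.2.1, Nat.factorial]; ring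
lemma z16 : HasSum (fun n : ℕ => 1 / (2 * (n : ℝ) + 1) ^ 16) (929569 / 83691159552000 * Real.pi ^ 16) := by
  have := hasSum_zeta_nat (k := 8) (by norm_num)
  convert! odd_zeta 16 (by norm_num) _ this using 1
  norm_num [bern12.2.2, Nat.factorial]; ring

lemma S2 (p : ℕ) : HasSum (fun k : ℕ => 1 / ((k:ℝ) - p) ^ 2 + 1 / ((k:ℝ) + p + 1) ^ 2) (Real.pi ^ 2 / 3) := by
  have := even_sum (fun n => 1 / (n:ℝ) ^ 2) (by simp) (by intro n; simp) _ (by simpa using hasSum_zeta_two) p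
  convert! this using 1
  · funext k; push_cast; rfl
  · ring
lemma S4 (p : ℕ) : HasSum (fun k : ℕ => 1 / ((k:ℝ) - p) ^ 4 + 1 / ((k:ℝ) + p + 1) ^ 4) (Real.pi ^ 4 / 45) := by
  have := even_sum (fun n => 1 / (n:ℝ) ^ 4) (by simp) (by intro n; simp [Even.neg_pow (show Even 4 by decide)]) _ (by simpa using hasSum_zeta_four) p
  convert! this using 1
  · funext k; push_cast; rfl
  · ring
lemma Sodd (i : ℕ) (hi : Odd i) (p : ℕ) : HasSum (fun k : ℕ => 1 / ((k:ℝ) - p) ^ i - 1 / ((k:ℝ) + p + 1) ^ i) 0 := by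
  have := odd_sum (fun n => 1 / (n:ℝ) ^ i) (by intro n; push_cast; rw [hi.neg_pow, div_neg]) (by
      intro m n hm hmn
      have : (0:ℝ) < m := by exact_mod_cast hm
      have : (m:ℝ) ≤ n := by exact_mod_cast hmn
      gcongr) (by
      have := (tendsto_inv_atTop_zero (𝕜 := ℝ)).comp ((tendsto_pow_atTop (α := ℝ) hi.pos.ne').comp tendsto_natCast_atTop_atTop)
      simpa [Function.comp_def] using this) p
  convert! this using 1
  funext k; push_cast; rfl

lemma row (p : ℕ) (a : ℝ) (ha : a = 2 * p + 1) :
    HasSum (fun k : ℕ => 1 / (a ^ 4 * (2 * (k:ℝ) + 1) ^ 4 * ((2 * (k:ℝ) + 1) ^ 2 - a ^ 2) ^ 4))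
      (-1795/256 * (1 / a ^ 16) + 233/384 * Real.pi ^ 2 * (1 / a ^ 14) + 121 / 11520 * Real.pi ^ 4 * (1 / a ^ 12)) := by
  have ha0 : a ≠ 0 := by rw [ha]; positivity
  have D : ∀ c : ℝ, HasSum (fun k : ℕ => if k = p then c else 0) c := fun c => hasSum_ite_eq p c
  set w : ℕ → ℝ := fun k => 1 / ((2 * (k:ℝ) + 1) ^ 2 - a ^ 2) with hw
  have wp : w p = 0 := by simp [hw, ha]
  have key : ∀ k : ℕ, k ≠ p → ((k:ℝ) - p ≠ 0 ∧ (k:ℝ) + p + 1 ≠ 0 ∧ w k = 1 / (4 * ((k:ℝ) - p) * (k + p + 1))) := by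
    intro k hk
    refine ⟨sub_ne_zero.2 (by exact_mod_cast hk), by positivity, ?_⟩
    simp only [hw]; congr 1; rw [ha]; ring
  have pp : (p:ℝ) + p + 1 = a := by rw [ha]; ring
  have uv : ∀ k : ℕ, k ≠ p → 1 / ((k:ℝ) - p) - 1 / ((k:ℝ) + p + 1) = 4 * a * w k ∧
      1 / ((k:ℝ) - p) * (1 / ((k:ℝ) + p + 1)) = 4 * w k := by
    intro k hk
    obtain ⟨h1, h2, h3⟩ := key k hk
    rw [h3, ha]
    constructor
    · field_simp; ring
    · field_simp
  have h1 : HasSum w (1 / (4 * a ^ 2)) := by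
    convert! ((Sodd 1 (by decide) p).add (D (1 / a))).mul_left (1 / (4 * a)) using 1
    · funext k
      by_cases hk : k = p
      · subst hk; simp [wp, pp]
      · rw [if_neg hk, add_zero, pow_one, pow_one, (uv k hk).1]; field_simp
    · field_simp; ring
  have h2 : HasSum (fun k => w k ^ 2) (-3/16 / a ^ 4 + Real.pi ^ 2 / 48 / a ^ 2) := by
    convert! (((S2 p).sub (D (1 / a ^ 2))).sub (h1.mul_left 8)).mul_left (1 / (16 * a ^ 2)) using 1
    · funext k
      by_cases hk : k = p
      · subst hk; simp [wp, pp]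
      · obtain ⟨e1, e2⟩ := uv k hk
        rw [if_neg hk, sub_zero, ← one_div_pow, ← one_div_pow]
        generalize 1 / ((k:ℝ) - p) = u at *
        generalize 1 / ((k:ℝ) + p + 1) = v at *
        have : u ^ 2 + v ^ 2 = 16 * a ^ 2 * w k ^ 2 + 8 * w k := by
          linear_combination (u - v + 4 * a * w k) * e1 + 2 * e2
        rw [this]; field_simp; ring
    · field_simp; ring
  have h3 : HasSum (fun k => w k ^ 3) (5/32 / a ^ 6 - Real.pi ^ 2 / 64 / a ^ 4) := by
    convert! (((Sodd 3 (by decide) p).add (D (1 / a ^ 3))).sub (h2.mul_left (48 * a))).mul_left (1 / (64 * a ^ 3)) using 1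
    · funext k
      by_cases hk : k = p
      · subst hk; simp [wp, pp]
      · obtain ⟨e1, e2⟩ := uv k hk
        rw [if_neg hk, add_zero, ← one_div_pow, ← one_div_pow]
        generalize 1 / ((k:ℝ) - p) = u at *
        generalize 1 / ((k:ℝ) + p + 1) = v at *
        have : u ^ 3 - v ^ 3 = 64 * a ^ 3 * w k ^ 3 + 48 * a * w k ^ 2 := by
          have hu : u = v + 4 * a * w k := by linarith
          have : u ^ 3 - v ^ 3 = (u - v) * ((u - v) ^ 2 + 3 * (u * v)) := by ring
          rw [this, e1, e2]; ring
        rw [this]; field_simp; ring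
    · field_simp; ring
  have h4 : HasSum (fun k => w k ^ 4) (-35/256 / a ^ 8 + 5 * Real.pi ^ 2 / 384 / a ^ 6 + Real.pi ^ 4 / 11520 / a ^ 4) := by
    convert! ((((S4 p).sub (D (1 / a ^ 4))).sub (h3.mul_left (256 * a ^ 2))).sub (h2.mul_left 32)).mul_left (1 / (256 * a ^ 4)) using 1
    · funext k
      by_cases hk : k = p
      · subst hk; simp [wp, pp]
      · obtain ⟨e1, e2⟩ := uv k hk
        rw [if_neg hk, sub_zero, ← one_div_pow, ← one_div_pow]
        generalize 1 / ((k:ℝ) - p) = u at *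
        generalize 1 / ((k:ℝ) + p + 1) = v at *
        have : u ^ 4 + v ^ 4 = 256 * a ^ 4 * w k ^ 4 + 256 * a ^ 2 * w k ^ 3 + 32 * w k ^ 2 := by
          have : u ^ 4 + v ^ 4 = ((u - v) ^ 2 + 2 * (u * v)) ^ 2 - 2 * (u * v) ^ 2 := by ring
          rw [this, e1, e2]; ring
        rw [this]; field_simp; ring
    · field_simp; ring
  convert! ((((((h4.mul_left (1 / a ^ 4)).sub (h3.mul_left (2 / a ^ 6))).add (h2.mul_left (3 / a ^ 8))).sub
    (h1.mul_left (4 / a ^ 10))).add ((z2.mul_left (4 / a ^ 10)).add (z4.mul_left (1 / a ^ 8)))).sub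
    (D (5 / a ^ 12))).mul_left (1 / a ^ 4) using 1
  · funext k
    by_cases hk : k = p
    · subst hk
      rw [if_pos rfl, wp, ← ha]
      simp
      right
      field_simp; ring
    · rw [if_neg hk]
      obtain ⟨k1, k2, k3⟩ := key k hk
      have hb : (2 * (k:ℝ) + 1) ^ 2 - a ^ 2 ≠ 0 := by
        rw [ha, show (2 * (k:ℝ) + 1) ^ 2 - (2 * p + 1) ^ 2 = 4 * ((k:ℝ) - p) * (k + p + 1) by ring]
        positivity
      have hb0 : 2 * (k:ℝ) + 1 ≠ 0 := by positivity
      simp only [hw]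
      generalize 2 * (k:ℝ) + 1 = b at *
      field_simp
      ring
  · field_simp; ring

/-- The value ζ₂PSp2(4,4,4,4): the sum over m,n ≥ 1 with m odd of
1/(m⁴n⁴(m+n)⁴(m+2n)⁴) equals (479/55794106368000)π¹⁶. -/
theorem zeta2_PSp2_four_four_four_four :
    (∑' pr : ℕ × ℕ, (if (pr.1 + 1) % 2 = 1 then
      (1 : ℝ) / (((pr.1 : ℝ) + 1) ^ 4 * ((pr.2 : ℝ) + 1) ^ 4
        * ((pr.1 : ℝ) + (pr.2 : ℝ) + 2) ^ 4
        * ((pr.1 : ℝ) + 2 * (pr.2 : ℝ) + 3) ^ 4) else 0))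
    = 479 / 55794106368000 * Real.pi ^ 16 := by
  set g : ℕ × ℕ → ℝ := fun q => 1 / ((2 * (q.1:ℝ) + 1) ^ 4 * (2 * (q.2:ℝ) + 1) ^ 4 *
    ((2 * (q.2:ℝ) + 1) ^ 2 - (2 * (q.1:ℝ) + 1) ^ 2) ^ 4) with hg
  have hgn : 0 ≤ g := fun q => by
    simp only [hg, Pi.zero_apply]
    positivity
  have hrow := fun p : ℕ => row p (2 * p + 1) rfl
  have hcol := ((z16.mul_left (-1795/256)).add (z14.mul_left (233/384 * Real.pi ^ 2))).add
    (z12.mul_left (121 / 11520 * Real.pi ^ 4))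
  have hgs : Summable g := by
    rw [summable_prod_of_nonneg hgn]
    refine ⟨fun p => (hrow p).summable, ?_⟩
    refine hcol.summable.congr ?_
    intro p
    exact (hrow p).tsum_eq.symm
  have htot : ∑' q, g q = 2 * (479 / 55794106368000 * Real.pi ^ 16 / 256) := by
    rw [hgs.tsum_prod]
    have : ∀ p : ℕ, ∑' k : ℕ, g (p, k) = _ := fun p => (hrow p).tsum_eq
    simp only [this]
    rw [hcol.tsum_eq]; ring
  set L : ℕ × ℕ → ℝ := fun q => if q.1 < q.2 then g q else 0 with hL
  have hsymm : ∀ q : ℕ × ℕ, g q.swap = g q := by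
    intro q; simp only [hg, Prod.fst_swap, Prod.snd_swap]; congr 1; ring
  have hLs : Summable L := by
    refine Summable.of_nonneg_of_le (fun q => ?_) (fun q => ?_) hgs
    · simp only [hL]; split_ifs; exacts [hgn q, le_rfl]
    · simp only [hL]; split_ifs; exacts [le_rfl, hgn q]
  have hsplit : ∀ q, g q = L q + L q.swap := by
    rintro ⟨p, k⟩
    have := hsymm (p, k)
    simp only [hL, Prod.swap, Prod.fst, Prod.snd] at *
    rcases lt_trichotomy p k with h | h | h
    · simp [h, h.le.not_gt]
    · subst h; simp [hg]
    · simp [h, h.le.not_gt, this]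
  have hL2 : ∑' q, g q = 2 * ∑' q, L q := by
    rw [tsum_congr hsplit]
    have hs : Summable (fun q : ℕ × ℕ => L q.swap) := hLs.prod_symm
    rw [hLs.tsum_add hs]
    have : ∑' q : ℕ × ℕ, L q.swap = ∑' q, L q := (Equiv.prodComm ℕ ℕ).tsum_eq L
    rw [this]; ring
  have hLv : ∑' q, L q = 479 / 55794106368000 * Real.pi ^ 16 / 256 := by linarith
  have i1 : Function.Injective (fun q : ℕ × ℕ => (q.1, q.1 + q.2 + 1)) := by
    rintro ⟨a, b⟩ ⟨c, d⟩ h; simp at h ⊢; omega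
  have i2 : Function.Injective (fun q : ℕ × ℕ => (2 * q.1, q.2)) := by
    rintro ⟨a, b⟩ ⟨c, d⟩ h; simp at h ⊢; omega
  rw [← i1.tsum_eq] at hLv
  · rw [← i2.tsum_eq]
    · rw [show 479 / 55794106368000 * Real.pi ^ 16 = 256 * (479 / 55794106368000 * Real.pi ^ 16 / 256) by ring, ← hLv,
        ← tsum_mul_left]
      congr 1
      funext q
      simp only [hL, hg]
      rw [if_pos (by omega), if_pos (by omega)]
      push_cast
      rw [show (2 * ((q.1:ℝ) + q.2 + 1) + 1) ^ 2 - (2 * (q.1:ℝ) + 1) ^ 2 = 4 * (q.2 + 1) * (2 * q.1 + q.2 + 2) by ring]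
      have e : (2 * (q.1:ℝ) + 2 * q.2 + 3) = 2 * ((q.1:ℝ) + q.2 + 1) + 1 := by ring
      rw [e]
      field_simp
      ring
    · rintro ⟨a, b⟩ h
      simp only [Function.mem_support, ne_eq, ite_eq_right_iff, Classical.not_imp] at h
      exact ⟨(a / 2, b), by simp; omega⟩
  · rintro ⟨a, b⟩ h
    simp only [hL, Function.mem_support, ne_eq, ite_eq_right_iff, Classical.not_imp] at h
    exact ⟨(a, b - a - 1), by simp; omega⟩
end

section
/- Σ over integers m,n ≥ 1 with m ≡ n (mod 3) of 1/(m·n·(m+n)) = (2/27)·ζ(3) + (2π/(3√3))·L(2,χ₃). -/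
/-- The primitive Dirichlet character of conductor 3, as a function on ℕ. -/
noncomputable def chiThree (n : ℕ) : ℂ :=
  if n % 3 = 1 then 1 else if n % 3 = 2 then -1 else 0

/-- The Dirichlet L-function value L(s,χ₃) = Σ_{n≥1} χ₃(n) n^{−s} for a natural
number exponent s. -/
noncomputable def LChiThree (s : ℕ) : ℂ :=
  ∑' n : ℕ, chiThree (n + 1) / ((n : ℂ) + 1) ^ s

namespace PU3

open Finset Filter Topology

/-- The real character. -/
noncomputable def chiR (n : ℕ) : ℝ :=
  if n % 3 = 1 then 1 else if n % 3 = 2 then -1 else 0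

/-- The double series term. -/
noncomputable def f (x : ℕ × ℕ) : ℝ :=
  if (x.1 + 1) % 3 = (x.2 + 1) % 3 then
    1 / (((x.1 : ℝ) + 1) * ((x.2 : ℝ) + 1) * ((x.1 : ℝ) + (x.2 : ℝ) + 2)) else 0

noncomputable def g (x : ℕ × ℕ) : ℝ :=
  if (x.1 + 1) % 3 = (x.2 + 1) % 3 then
    1 / (((x.2 : ℝ) + 1) * ((x.1 : ℝ) + (x.2 : ℝ) + 2) ^ 2) else 0

noncomputable def B (p : ℕ) : ℝ :=
  ∑ q ∈ range p, if (q + p + 2) % 3 = 0 then 1 / ((q : ℝ) + 1) else 0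

lemma f_nonneg (x : ℕ × ℕ) : 0 ≤ f x := by
  unfold f; split_ifs <;> positivity

lemma g_nonneg (x : ℕ × ℕ) : 0 ≤ g x := by
  unfold g; split_ifs <;> positivity

lemma f_eq (x : ℕ × ℕ) : f x = g x + g x.swap := by
  obtain ⟨p, q⟩ := x
  unfold f g
  simp only [Prod.swap]
  by_cases h : (p + 1) % 3 = (q + 1) % 3
  · rw [if_pos h, if_pos h, if_pos h.symm]
    have h1 : (p : ℝ) + 1 ≠ 0 := by positivity
    have h2 : (q : ℝ) + 1 ≠ 0 := by positivity
    have h3 : (p : ℝ) + q + 2 ≠ 0 := by positivity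
    have h4 : (q : ℝ) + p + 2 ≠ 0 := by positivity
    field_simp
    ring
  · rw [if_neg h, if_neg h, if_neg (fun h' => h h'.symm), add_zero]

lemma summable_f : Summable f := by
  have h1 : Summable (fun n : ℕ => 1 / |(n : ℝ) + 1| ^ (3 / 2 : ℝ)) :=
    (Real.summable_one_div_nat_add_rpow 1 (3 / 2)).2 (by norm_num)
  have h2 := h1.mul_of_nonneg h1 (fun n => by positivity) (fun n => by positivity)
  refine Summable.of_nonneg_of_le f_nonneg ?_ h2
  rintro ⟨p, q⟩
  have hp : (0 : ℝ) < (p : ℝ) + 1 := by positivity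
  have hq : (0 : ℝ) < (q : ℝ) + 1 := by positivity
  have key : ∀ x : ℝ, 0 < x → x ^ (3 / 2 : ℝ) = x * √x := by
    intro x hx
    rw [Real.sqrt_eq_rpow, show (3 / 2 : ℝ) = 1 + 1 / 2 by norm_num, Real.rpow_add hx,
      Real.rpow_one]
  have hb : f (p, q) ≤ 1 / (((p : ℝ) + 1) * ((q : ℝ) + 1) * ((p : ℝ) + (q : ℝ) + 2)) := by
    unfold f; split_ifs
    · exact le_refl _
    · positivity
  refine hb.trans ?_
  simp only [abs_of_pos hp, abs_of_pos hq, key _ hp, key _ hq]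
  rw [div_mul_div_comm, one_mul]
  apply one_div_le_one_div_of_le
  · positivity
  · have e1 := Real.sq_sqrt hp.le
    have e2 := Real.sq_sqrt hq.le
    have h3 : √((p : ℝ) + 1) * √((q : ℝ) + 1) ≤ (p : ℝ) + q + 2 := by
      nlinarith [sq_nonneg (√((p : ℝ) + 1) - √((q : ℝ) + 1)), sq_nonneg (√((p : ℝ) + 1)), sq_nonneg (√((q : ℝ) + 1))]
    calc _ = ((p : ℝ) + 1) * ((q : ℝ) + 1) * (√((p : ℝ) + 1) * √((q : ℝ) + 1)) := by ring
      _ ≤ _ := by gcongr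

lemma summable_g : Summable g :=
  Summable.of_nonneg_of_le g_nonneg
    (fun x => by rw [f_eq]; linarith [g_nonneg x.swap]) summable_f

lemma tsum_f : ∑' x, f x = 2 * ∑' x, g x := by
  have h : HasSum (fun x : ℕ × ℕ => g x.swap) (∑' x, g x) :=
    ((Equiv.prodComm ℕ ℕ).hasSum_iff (f := g)).2 summable_g.hasSum
  have := (summable_g.hasSum.add h).tsum_eq
  rw [two_mul, ← this]
  exact tsum_congr f_eq

lemma hasSum_B : HasSum (fun p : ℕ => B p / ((p : ℝ) + 1) ^ 2) (∑' x, g x) := by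
  have h1 : HasSum (fun x : (Σ n : ℕ, antidiagonal n) => g x.2.1) (∑' x, g x) :=
    (HasAntidiagonal.sigmaAntidiagonalEquivProd.hasSum_iff (f := g)).2 summable_g.hasSum
  have h2 := h1.sigma (fun n => hasSum_fintype _)
  have h3 : ∀ n : ℕ, ∑ c : antidiagonal n, g c.1 = B (n + 1) / (((n + 1 : ℕ) : ℝ) + 1) ^ 2 := by
    intro n
    rw [Finset.sum_coe_sort (antidiagonal n) g, ← Nat.sum_antidiagonal_swap,
      Nat.sum_antidiagonal_eq_sum_range_succ_mk, B, Finset.sum_div]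
    refine Finset.sum_congr rfl fun q hq => ?_
    have hq' : q ≤ n := by simpa [Nat.lt_succ_iff] using hq
    obtain ⟨p, rfl⟩ := Nat.exists_eq_add_of_le hq'
    simp only [Prod.swap, g]
    have e : (q + p - q + 1) % 3 = (q + 1) % 3 ↔ (q + (q + p + 1) + 2) % 3 = 0 := by omega
    by_cases h : (q + p - q + 1) % 3 = (q + 1) % 3
    · rw [if_pos h, if_pos (e.1 h), Nat.add_sub_cancel_left]
      push_cast
      rw [div_div]
      congr 2
      ring
    · rw [if_neg h, if_neg (fun h' => h (e.2 h')), zero_div]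
  simp only [h3] at h2
  have := (hasSum_nat_add_iff (f := fun p : ℕ => B p / ((p : ℝ) + 1) ^ 2) 1).1 h2
  simpa [B] using this

lemma telescope1 (c : ℝ) (hc : 0 < c) :
    HasSum (fun k : ℕ => 1 / (3 * (k : ℝ) + c) - 1 / (3 * ((k + 1 : ℕ) : ℝ) + c)) (1 / c) := by
  rw [hasSum_iff_tendsto_nat_of_nonneg]
  · simp_rw [Finset.sum_range_sub' (fun k : ℕ => 1 / (3 * (k : ℝ) + c))]
    have : Tendsto (fun n : ℕ => 1 / (3 * (n : ℝ) + c)) atTop (𝓝 0) := by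
      simp_rw [one_div]
      apply Tendsto.inv_tendsto_atTop
      apply tendsto_atTop_add_const_right
      exact tendsto_natCast_atTop_atTop.const_mul_atTop (by norm_num)
    simpa using this.const_sub (1 / c)
  · intro k
    rw [sub_nonneg]
    apply one_div_le_one_div_of_le
    · positivity
    · push_cast; linarith

lemma telescope (c : ℝ) (hc : 0 < c) (a : ℕ) :
    HasSum (fun k : ℕ => 1 / (3 * (k : ℝ) + c) - 1 / (3 * ((k + a : ℕ) : ℝ) + c))
      (∑ i ∈ range a, 1 / (3 * (i : ℝ) + c)) := by
  induction a with
  | zero => simpa using hasSum_zero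
  | succ a ih =>
    rw [sum_range_succ]
    have := ih.add (telescope1 (3 * a + c) (by positivity))
    convert this using 2 with k
    push_cast
    ring

noncomputable def L1 : ℝ := Real.pi / (3 * √3)

lemma hasSum_L1 :
    HasSum (fun k : ℕ => 1 / (3 * (k : ℝ) + 1) - 1 / (3 * (k : ℝ) + 2)) L1 := by
  have hz : (1 / 3 : ℂ) ∈ Complex.integerComplement := by
    rintro ⟨n, hn⟩
    have : (3 * n : ℂ) = 1 := by rw [hn]; norm_num
    norm_cast at this
    omega
  have h1 := (Summable.hasSum (summable_cotTerm hz))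
  have h2 := cot_series_rep' hz
  have h3 : Complex.cot (Real.pi * (1 / 3)) = ((1 / √3 : ℝ) : ℂ) := by
    rw [show (Real.pi : ℂ) * (1 / 3) = ((Real.pi / 3 : ℝ) : ℂ) by push_cast; ring,
      ← Complex.ofReal_cot, Real.cot_eq_cos_div_sin, Real.cos_pi_div_three,
      Real.sin_pi_div_three]
    congr 1
    have : √3 ≠ 0 := by positivity
    field_simp
  have h4 : HasSum (fun k : ℕ => 3 * (1 / (3 * (k : ℝ) + 4) - 1 / (3 * (k : ℝ) + 2)))
      (Real.pi * (1 / √3) - 3) := by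
    rw [← Complex.hasSum_ofReal]
    have : ((Real.pi * (1 / √3) - 3 : ℝ) : ℂ) = ∑' n : ℕ, cotTerm (1 / 3) n := by
      rw [h3] at h2
      simp only [cotTerm]
      rw [← h2]
      push_cast
      norm_num
    rw [this]
    convert h1 using 2 with k
    simp only [cotTerm]
    have e1 : (3 * (k : ℂ) + 4) ≠ 0 := by norm_cast
    have e2 : (3 * (k : ℂ) + 2) ≠ 0 := by norm_cast
    have e3 : (1 / 3 - ((k : ℂ) + 1)) = - (3 * (k : ℂ) + 2) / 3 := by ring
    have e4 : (1 / 3 + ((k : ℂ) + 1)) = (3 * (k : ℂ) + 4) / 3 := by ring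
    rw [e3, e4]
    push_cast
    field_simp
    ring
  have h5 := (h4.div_const 3).add (telescope1 1 one_pos)
  convert h5 using 2 with k
  · rfl
  · push_cast; ring
  · unfold L1
    have : √3 ≠ 0 := by positivity
    field_simp
    ring

lemma sumB0 (a : ℕ) : B (3 * a) = ∑ i ∈ range a, 1 / (3 * (i : ℝ) + 2) := by
  have : ∀ N, ∑ q ∈ range (3 * N), (if (q + 3 * a + 2) % 3 = 0 then 1 / ((q : ℝ) + 1) else 0)
      = ∑ i ∈ range N, 1 / (3 * (i : ℝ) + 2) := by
    intro N
    induction N with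
    | zero => simp
    | succ N ih =>
      rw [show 3 * (N + 1) = 3 * N + 1 + 1 + 1 by ring, sum_range_succ, sum_range_succ,
        sum_range_succ, ih, sum_range_succ, if_neg (by omega), if_pos (by omega),
        if_neg (by omega)]
      push_cast
      ring_nf
  exact this a

lemma sumB1 (a : ℕ) : B (3 * a + 1) = ∑ i ∈ range (a + 1), 1 / (3 * (i : ℝ) + 1) := by
  have : ∀ N, ∑ q ∈ range (3 * N + 1),
      (if (q + (3 * a + 1) + 2) % 3 = 0 then 1 / ((q : ℝ) + 1) else 0)
      = ∑ i ∈ range (N + 1), 1 / (3 * (i : ℝ) + 1) := by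
    intro N
    induction N with
    | zero => 
      simp
      omega
    | succ N ih =>
      rw [show 3 * (N + 1) + 1 = 3 * N + 1 + 1 + 1 + 1 by ring, sum_range_succ, sum_range_succ,
        sum_range_succ, ih, sum_range_succ _ (N + 1), if_neg (by omega), if_neg (by omega),
        if_pos (by omega)]
      push_cast
      ring_nf
  exact this a

lemma sumB2 (a : ℕ) : B (3 * a + 2) = ∑ i ∈ range a, 1 / (3 * (i : ℝ) + 3) := by
  have : ∀ N, ∑ q ∈ range (3 * N + 2),
      (if (q + (3 * a + 2) + 2) % 3 = 0 then 1 / ((q : ℝ) + 1) else 0)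
      = ∑ i ∈ range N, 1 / (3 * (i : ℝ) + 3) := by
    intro N
    induction N with
    | zero =>
      rw [sum_range_succ, sum_range_succ, if_neg (by omega), if_neg (by omega)]
      simp
    | succ N ih =>
      rw [show 3 * (N + 1) + 2 = 3 * N + 2 + 1 + 1 + 1 by ring, sum_range_succ, sum_range_succ,
        sum_range_succ, ih, sum_range_succ _ N, if_pos (by omega), if_neg (by omega),
        if_neg (by omega)]
      push_cast
      ring_nf
  exact this a

/-- the diagonal term -/
noncomputable def D (p : ℕ) : ℝ := if (p + 1) % 3 = 0 then 1 / ((p : ℝ) + 1) ^ 3 else 0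

lemma reindex (p r : ℕ) (hr : r = p % 3) (s : ℝ)
    (h : HasSum (fun k : ℕ => 1 / (3 * (k : ℝ) + r + 1) - 1 / (3 * (k : ℝ) + r + 1 + (p + 1))) s) :
    HasSum (fun q => f (p, q)) (s / ((p : ℝ) + 1) ^ 2) := by
  have hinj : Function.Injective (fun k : ℕ => 3 * k + r) := by
    intro a b hab
    try simp only at hab
    omega
  refine (hinj.hasSum_iff ?_).1 ?_
  · intro q hq
    unfold f
    rw [if_neg]
    intro h'
    try simp only at h'
    exact hq ⟨q / 3, by grind⟩
  · convert h.div_const (((p : ℝ) + 1) ^ 2) using 2 with k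
    · rfl
    simp only [Function.comp, f]
    rw [if_pos (by omega)]
    push_cast
    have h1 : (p : ℝ) + 1 ≠ 0 := by positivity
    have h2 : 3 * (k : ℝ) + r + 1 ≠ 0 := by positivity
    have h3 : (p : ℝ) + (3 * k + r) + 2 ≠ 0 := by positivity
    have h4 : 3 * (k : ℝ) + r + 1 + (p + 1) ≠ 0 := by positivity
    field_simp
    ring

lemma inner (p : ℕ) : HasSum (fun q => f (p, q))
    (B p / ((p : ℝ) + 1) ^ 2 + (L1 * (chiR (p + 1) / ((p : ℝ) + 1) ^ 2) + D p)) := by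
  have hp : p = 3 * (p / 3) ∨ p = 3 * (p / 3) + 1 ∨ p = 3 * (p / 3) + 2 := by omega
  generalize p / 3 = a at hp
  rcases hp with rfl | rfl | rfl
  · have := reindex (3 * a) 0 (by omega) (L1 + B (3 * a)) (by
      rw [sumB0]
      convert hasSum_L1.add (telescope 2 two_pos a) using 2 with k
      push_cast
      ring)
    convert this using 1
    rw [chiR, D, if_pos (by omega), if_neg (by omega)]
    ring
  · have := reindex (3 * a + 1) 1 (by omega) (B (3 * a + 1) - L1) (by
      rw [sumB1]
      convert (telescope 1 one_pos (a + 1)).sub hasSum_L1 using 2 with k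
      · rfl
      · push_cast
        ring)
    convert this using 1
    rw [chiR, D, if_neg (by omega), if_pos (by omega), if_neg (by omega)]
    ring
  · have := reindex (3 * a + 2) 2 (by omega) (B (3 * a + 2) + 1 / (3 * a + 3)) (by
      rw [sumB2, ← sum_range_succ (fun i : ℕ => 1 / (3 * (i : ℝ) + 3))]
      convert (telescope 3 three_pos (a + 1)) using 2 with k
      push_cast
      ring)
    convert this using 1
    rw [chiR, D, if_neg (by omega), if_neg (by omega), if_pos (by omega)]
    push_cast
    have : 3 * (a : ℝ) + 3 ≠ 0 := by positivity
    rw [show 3 * (a : ℝ) + 2 + 1 = 3 * a + 3 by ring]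
    field_simp
    ring

lemma hasSum_D : HasSum D (∑' n : ℕ, 1 / ((n : ℝ) + 1) ^ 3 / 27) := by
  have hs : Summable (fun n : ℕ => 1 / ((n : ℝ) + 1) ^ 3) := by
    have := (summable_nat_add_iff 1).2 (Real.summable_one_div_nat_pow.2 (by norm_num : 1 < 3))
    simpa using this
  have hinj : Function.Injective (fun k : ℕ => 3 * k + 2) := by
    intro a b hab
    try simp only at hab
    omega
  refine (hinj.hasSum_iff ?_).1 ?_
  · intro q hq
    unfold D
    rw [if_neg]
    intro h'
    exact hq ⟨q / 3, by grind⟩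
  · convert (hs.div_const 27).hasSum using 2 with k
    · rfl
    simp only [Function.comp, D]
    rw [if_pos (by omega)]
    push_cast
    have h1 : (k : ℝ) + 1 ≠ 0 := by positivity
    rw [show 3 * (k : ℝ) + 2 + 1 = 3 * (k + 1) by ring]
    field_simp
    norm_num

lemma summable_chi : Summable (fun n : ℕ => chiR (n + 1) / ((n : ℝ) + 1) ^ 2) := by
  have hs : Summable (fun n : ℕ => 1 / ((n : ℝ) + 1) ^ 2) := by
    have := (summable_nat_add_iff 1).2 (Real.summable_one_div_nat_pow.2 (by norm_num : 1 < 2))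
    simpa using this
  refine Summable.of_norm_bounded hs fun n => ?_
  rw [norm_div, Real.norm_eq_abs, Real.norm_eq_abs, abs_of_nonneg (by positivity : (0 : ℝ) ≤ ((n : ℝ) + 1) ^ 2)]
  gcongr
  unfold chiR
  split_ifs <;> norm_num

lemma main : ∑' x, f x = 2 * (L1 * ∑' n : ℕ, chiR (n + 1) / ((n : ℝ) + 1) ^ 2
    + ∑' n : ℕ, 1 / ((n : ℝ) + 1) ^ 3 / 27) := by
  have h1 := summable_f.hasSum.prod_fiberwise inner
  have h2 := hasSum_B.add ((summable_chi.hasSum.mul_left L1).add hasSum_D)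
  have h3 := h1.unique h2
  have h4 := tsum_f
  linarith

end PU3

/-- ζ₂PU3(1,1,1): the sum over m,n ≥ 1 with m ≡ n (mod 3) of 1/(mn(m+n))
equals (2/27)ζ(3) + (2π/(3√3))L(2,χ₃). -/
theorem zeta2_PU3_one_one_one :
    (∑' pr : ℕ × ℕ, (if (pr.1 + 1) % 3 = (pr.2 + 1) % 3 then
      (1 : ℂ) / (((pr.1 : ℂ) + 1) * ((pr.2 : ℂ) + 1)
        * ((pr.1 : ℂ) + (pr.2 : ℂ) + 2)) else 0))
    = 2 / 27 * riemannZeta 3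
      + 2 * (Real.pi : ℂ) / (3 * (Real.sqrt 3 : ℂ)) * LChiThree 2 := by
  have h1 : ∀ pr : ℕ × ℕ, (if (pr.1 + 1) % 3 = (pr.2 + 1) % 3 then
      (1 : ℂ) / (((pr.1 : ℂ) + 1) * ((pr.2 : ℂ) + 1)
        * ((pr.1 : ℂ) + (pr.2 : ℂ) + 2)) else 0) = ((PU3.f pr : ℝ) : ℂ) := by
    intro pr
    unfold PU3.f
    split_ifs <;> push_cast <;> rfl
  have h2 : LChiThree 2 = ((∑' n : ℕ, PU3.chiR (n + 1) / ((n : ℝ) + 1) ^ 2 : ℝ) : ℂ) := by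
    rw [Complex.ofReal_tsum]
    unfold LChiThree
    refine tsum_congr fun n => ?_
    unfold chiThree PU3.chiR
    split_ifs <;> push_cast <;> rfl
  have h3 : riemannZeta 3 = 27 * ((∑' n : ℕ, 1 / ((n : ℝ) + 1) ^ 3 / 27 : ℝ) : ℂ) := by
    have h := zeta_eq_tsum_one_div_nat_add_one_cpow (s := 3) (by norm_num)
    rw [h, tsum_div_const, Complex.ofReal_div, Complex.ofReal_tsum]
    push_cast
    rw [mul_div_cancel₀ _ (by norm_num)]
    refine tsum_congr fun n => ?_
    norm_cast
  rw [tsum_congr h1, ← Complex.ofReal_tsum, PU3.main, h2, h3, PU3.L1]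
  push_cast
  ring
end

section
/- Σ over integers m,n ≥ 1 with m ≡ n (mod 3) of 1/(m²·n²·(m+n)) = −(1/81)·ζ(5) + (35π²/243)·ζ(3) − (2π/(3√3))·L(4,χ₃). -/
open Filter Topology

lemma pu_conv {ι : Type} {f g : ι → ℂ} {a b : ℂ} (h : HasSum f a) (hfg : ∀ i, g i = f i)
    (hab : b = a) : HasSum g b := by
  have : g = f := funext hfg
  rw [this, hab]
  exact h

lemma pu_norm_inv_int_le (k : ℤ) : ‖((k : ℂ))⁻¹‖ ≤ 1 := by
  rcases eq_or_ne k 0 with rfl | h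
  · simp
  · rw [norm_inv, Complex.norm_intCast]
    apply inv_le_one_of_one_le₀
    exact_mod_cast Int.one_le_abs h

lemma pu_summable_sq : Summable (fun m : ℤ => (((m : ℂ)) ^ 2)⁻¹) := by
  apply Summable.of_norm
  have h := (Real.summable_one_div_int_pow (p := 2)).2 (by norm_num)
  refine h.congr fun m => ?_
  rw [norm_inv, norm_pow, Complex.norm_intCast, sq_abs, one_div]

noncomputable def puP (N m : ℤ) : ℂ := ((m : ℂ) ^ 2 * ((m : ℂ) + N))⁻¹

lemma pu_P_norm (N m : ℤ) : ‖puP N m‖ ≤ ‖(((m : ℂ)) ^ 2)⁻¹‖ := by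
  unfold puP
  rw [mul_inv, norm_mul]
  have := pu_norm_inv_int_le (m + N)
  push_cast at this
  exact mul_le_of_le_one_right (norm_nonneg _) this

lemma pu_P_summable (N : ℤ) : Summable (puP N) :=
  Summable.of_norm_bounded pu_summable_sq.norm (pu_P_norm N)

lemma pu_pf (N m : ℤ) (hN : N ≠ 0) : puP N m =
    (N : ℂ)⁻¹ * ((m : ℂ) ^ 2)⁻¹ + ((N : ℂ) ^ 2)⁻¹ * (((m : ℂ) + N)⁻¹ - (m : ℂ)⁻¹)
    - (if m = 0 then ((N : ℂ) ^ 3)⁻¹ else 0) - (if m = -N then 2 * ((N : ℂ) ^ 3)⁻¹ else 0) := by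
  unfold puP
  have hN' : (N : ℂ) ≠ 0 := by exact_mod_cast hN
  by_cases h0 : m = 0
  · have : ¬ (0 = -N) := by omega
    subst h0
    simp [hN]
    field_simp
    simp
  · by_cases h1 : m = -N
    · subst h1
      simp [hN]
      field_simp
      ring
    · have a : (m : ℂ) ≠ 0 := by exact_mod_cast h0
      have b : (m : ℂ) + N ≠ 0 := by
        have : m + N ≠ 0 := by omega
        exact_mod_cast this
      simp only [h0, h1, if_false]
      field_simp
      ring

lemma pu_d_summable (N : ℤ) (hN : N ≠ 0) :
    Summable (fun m : ℤ => ((m : ℂ) + N)⁻¹ - (m : ℂ)⁻¹) := by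
  have hN' : (N : ℂ) ≠ 0 := by exact_mod_cast hN
  have h1 := (pu_P_summable N)
  have h2 := pu_summable_sq.mul_left ((N : ℂ)⁻¹)
  have h3 := (hasSum_ite_eq (0 : ℤ) (((N : ℂ) ^ 3)⁻¹)).summable
  have h4 := (hasSum_ite_eq (-N : ℤ) (2 * ((N : ℂ) ^ 3)⁻¹)).summable
  refine ((((h1.sub h2).add h3).add h4).mul_left ((N : ℂ) ^ 2)).congr fun m => ?_
  rw [pu_pf N m hN]
  field_simp
  ring

lemma pu_inv_tendsto (a : ℤ) : Tendsto (fun n : ℕ => ((3 * (n : ℂ) + a))⁻¹) atTop (𝓝 0) := by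
  apply tendsto_inv₀_cobounded.comp
  rw [← tendsto_norm_atTop_iff_cobounded]
  have : Tendsto (fun n : ℕ => (n : ℝ) - ‖(a : ℂ)‖) atTop atTop :=
    tendsto_atTop_add_const_right _ _ tendsto_natCast_atTop_atTop
  refine tendsto_atTop_mono (fun n => ?_) this
  have h := norm_sub_le (3 * (n : ℂ) + a) a
  have h2 : ‖(3 * (n : ℂ) + a) - a‖ = 3 * n := by simp
  have : (0 : ℝ) ≤ n := by positivity
  linarith

lemma pu_tel (a : ℤ) :
    HasSum (fun j : ℤ => (3 * (j : ℂ) + a + 3)⁻¹ - (3 * (j : ℂ) + a)⁻¹) 0 := by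
  have hs : Summable (fun j : ℤ => (3 * (j : ℂ) + a + 3)⁻¹ - (3 * (j : ℂ) + a)⁻¹) := by
    have := (pu_d_summable 3 (by norm_num)).comp_injective
      (i := fun j : ℤ => 3 * j + a) (fun x y h => by simpa using h)
    refine this.congr fun j => ?_
    simp
  have hh := And.intro (hs.comp_injective (i := fun n : ℕ => (n : ℤ)) Nat.cast_injective)
    (hs.comp_injective (i := fun n : ℕ => (-((n : ℤ) + 1))) (fun x y h => by simpa using h))
  have h1 : HasSum (fun n : ℕ => (3 * ((n : ℤ) : ℂ) + a + 3)⁻¹ - (3 * ((n : ℤ) : ℂ) + a)⁻¹)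
      (0 - (a : ℂ)⁻¹) := by
    refine (hh.1.hasSum_iff_tendsto_nat).2 ?_
    have := (pu_inv_tendsto a).sub_const ((a : ℂ)⁻¹)
    refine this.congr fun n => ?_
    have := Finset.sum_range_sub (fun n : ℕ => ((3 * (n : ℂ) + a))⁻¹) n
    simp at this
    rw [← this, ← Finset.sum_sub_distrib]
    refine Finset.sum_congr rfl fun i _ => ?_
    simp only [Function.comp]
    push_cast
    ring_nf
  have h2 : HasSum (fun n : ℕ => (3 * ((-((n : ℤ) + 1) : ℤ) : ℂ) + a + 3)⁻¹
      - (3 * ((-((n : ℤ) + 1) : ℤ) : ℂ) + a)⁻¹)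
      (0 - -(a : ℂ)⁻¹) := by
    refine (hh.2.hasSum_iff_tendsto_nat).2 ?_
    have := (pu_inv_tendsto (-a)).sub_const (-(a : ℂ)⁻¹)
    refine this.congr fun n => ?_
    have := Finset.sum_range_sub (fun n : ℕ => ((3 * (n : ℂ) + (-a : ℤ)))⁻¹) n
    simp only [Nat.cast_zero, mul_zero, zero_add, Int.cast_neg, inv_neg] at this
    simp only [Int.cast_neg]
    rw [← this]
    refine Finset.sum_congr rfl fun i _ => ?_
    have e1 : (3 * ((-((i : ℤ) + 1) : ℤ) : ℂ) + a + 3) = - (3 * (i:ℂ) + -a) := by push_cast; ring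
    have e2 : (3 * ((-((i : ℤ) + 1) : ℤ) : ℂ) + a) = - (3 * ((i+1 : ℕ):ℂ) + -a) := by
      push_cast; ring
    simp only [Function.comp]
    rw [e1, e2, inv_neg, inv_neg]
    ring
  have := HasSum.of_nat_of_neg_add_one (f := fun j : ℤ => (3 * (j : ℂ) + a + 3)⁻¹ - (3 * (j : ℂ) + a)⁻¹) h1 h2
  simpa using this

lemma pu_telk (a : ℤ) (k : ℕ) :
    HasSum (fun j : ℤ => (3 * (j : ℂ) + a + 3 * k)⁻¹ - (3 * (j : ℂ) + a)⁻¹) 0 := by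
  induction k with
  | zero => simp
  | succ k ih =>
    have := (pu_tel (a + 3 * k)).add ih
    rw [add_zero] at this
    convert this using 2 with j
    push_cast
    ring_nf

lemma pu_cot : HasSum (fun j : ℤ => (3 * (j : ℂ) - 1)⁻¹ - (3 * (j : ℂ) + 1)⁻¹)
    (- (2 * Real.pi / (3 * (Real.sqrt 3 : ℂ)))) := by
  have hs : Summable (fun j : ℤ => (3 * (j : ℂ) - 1)⁻¹ - (3 * (j : ℂ) + 1)⁻¹) := by
    have := (pu_d_summable (-2) (by norm_num)).comp_injective
      (i := fun j : ℤ => 3 * j + 1) (fun x y h => by simpa using h)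
    refine this.congr fun j => ?_
    simp
    ring
  have hx : (1/3 : ℂ) ∈ Complex.integerComplement := by
    rw [Complex.mem_integerComplement_iff]
    rintro ⟨n, hn⟩
    have : (3 * n : ℂ) = 1 := by rw [hn]; norm_num
    have : 3 * n = 1 := by exact_mod_cast this
    omega
  have h1 := cot_series_rep' hx
  have hc : Complex.cot (Real.pi * (1/3)) = (1 / (Real.sqrt 3 : ℂ)) := by
    have e : ((Real.pi : ℂ) * (1/3)) = ((Real.pi / 3 : ℝ) : ℂ) := by push_cast; ring
    rw [e, ← Complex.ofReal_cot, Real.cot_eq_cos_div_sin, Real.cos_pi_div_three, Real.sin_pi_div_three]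
    push_cast
    have : (Real.sqrt 3 : ℂ) ≠ 0 := by simp
    field_simp
  have h2 := hs.hasSum.nat_add_neg
  have h3 := hs.hasSum
  have h4 := ((hasSum_nat_add_iff' 1).2 h2).tsum_eq
  rw [hc] at h1
  have h5 : ∀ n : ℕ, (1 / ((1/3 : ℂ) - (n + 1)) + 1 / (1/3 + (n + 1))) =
    (-3/2) * (((3 * (((n+1 : ℕ):ℤ) : ℂ) - 1)⁻¹ - (3 * (((n+1:ℕ):ℤ) : ℂ) + 1)⁻¹) + 
     ((3 * ((-((n+1 : ℕ):ℤ) : ℤ) : ℂ) - 1)⁻¹ - (3 * ((-((n+1:ℕ):ℤ) : ℤ): ℂ) + 1)⁻¹)) := by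
    intro n
    have e1 : (1/3 : ℂ) - (n + 1) = - (1/3) * (3 * (n + 1) - 1) := by ring
    have e2 : (1/3 : ℂ) + (n + 1) = (1/3) * (3 * (n + 1) + 1) := by ring
    have e3 : (3 * ((-((n+1 : ℕ):ℤ) : ℤ) : ℂ) - 1) = - (3 * (n + 1) + 1) := by push_cast; ring
    have e4 : (3 * ((-((n+1 : ℕ):ℤ) : ℤ) : ℂ) + 1) = - (3 * (n + 1) - 1) := by push_cast; ring
    rw [e1, e2, e3, e4]
    push_cast
    simp only [one_div, mul_inv, inv_neg, inv_inv]
    ring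
  rw [tsum_congr h5, tsum_mul_left, h4] at h1
  convert h3 using 1
  simp at h1
  have : (Real.sqrt 3 : ℂ) ≠ 0 := by simp
  field_simp at h1 ⊢
  linear_combination -h1

lemma pu_reindex (f : ℤ → ℂ) (a : ℤ) (s : ℂ) :
    HasSum (fun m : ℤ => if (m - a) % 3 = 0 then f m else 0) s ↔
      HasSum (fun j : ℤ => f (3 * j + a)) s := by
  have hi : Function.Injective (fun j : ℤ => 3 * j + a) := fun x y h => by simpa using h
  rw [← hi.hasSum_iff]
  · have : ((fun m : ℤ => if (m - a) % 3 = 0 then f m else 0) ∘ fun j : ℤ => 3 * j + a) =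
        (fun j : ℤ => f (3 * j + a)) := by
      funext j
      have : (3 * j + a - a) % 3 = 0 := by omega
      simp only [Function.comp, this, if_true]
    rw [this]
  · intro x hx
    rw [if_neg]
    intro h
    exact hx ⟨(x - a) / 3, by simp only; omega⟩

lemma pu_sq : HasSum (fun m : ℤ => ((m : ℂ) ^ 2)⁻¹) (Real.pi ^ 2 / 3) := by
  have h : HasSum (fun n : ℕ => ((((n : ℤ)) : ℂ) ^ 2)⁻¹) (Real.pi ^ 2 / 6) := by
    have := Complex.hasSum_ofReal.2 hasSum_zeta_two
    push_cast at this
    simpa using this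
  have h2 : HasSum (fun n : ℕ => (((-(n : ℤ) : ℤ) : ℂ) ^ 2)⁻¹) (Real.pi ^ 2 / 6) := by
    simpa using h
  have := HasSum.of_nat_of_neg (f := fun m : ℤ => ((m : ℂ) ^ 2)⁻¹) h h2
  refine pu_conv this (fun _ => rfl) ?_
  norm_num
  ring

lemma pu_sq0 : HasSum (fun j : ℤ => (((3 * j + 0 : ℤ) : ℂ) ^ 2)⁻¹) (Real.pi ^ 2 / 27) := by
  refine pu_conv (pu_sq.mul_left (1 / 9)) (fun j => ?_) ?_
  · push_cast
    rw [add_zero, mul_pow, mul_inv]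
    norm_num
  · ring

lemma pu_sq12 : HasSum (fun j : ℤ => (((3 * j + 1 : ℤ) : ℂ) ^ 2)⁻¹) (4 * Real.pi ^ 2 / 27) ∧
    HasSum (fun j : ℤ => (((3 * j + 2 : ℤ) : ℂ) ^ 2)⁻¹) (4 * Real.pi ^ 2 / 27) := by
  have s1 : Summable (fun j : ℤ => (((3 * j + 1 : ℤ) : ℂ) ^ 2)⁻¹) :=
    pu_summable_sq.comp_injective (i := fun j : ℤ => 3 * j + 1) (fun x y h => by simpa using h)
  obtain ⟨A, h1⟩ := s1
  have h2 : HasSum (fun j : ℤ => (((3 * j + 2 : ℤ) : ℂ) ^ 2)⁻¹) A := by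
    rw [← (Equiv.subLeft (-1 : ℤ)).hasSum_iff] at h1
    convert h1 using 1
    funext j
    simp only [Function.comp, Equiv.subLeft_apply]
    push_cast
    congr 1
    ring
  have t0 := (pu_reindex (fun m => ((m : ℂ) ^ 2)⁻¹) 0 _).2 pu_sq0
  have t1 := (pu_reindex (fun m => ((m : ℂ) ^ 2)⁻¹) 1 _).2 h1
  have t2 := (pu_reindex (fun m => ((m : ℂ) ^ 2)⁻¹) 2 _).2 h2
  have t := (t0.add t1).add t2
  have e : (fun m : ℤ => ((m : ℂ) ^ 2)⁻¹) = fun m : ℤ =>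
      (if (m - 0) % 3 = 0 then ((m : ℂ) ^ 2)⁻¹ else 0) +
      (if (m - 1) % 3 = 0 then ((m : ℂ) ^ 2)⁻¹ else 0) +
      (if (m - 2) % 3 = 0 then ((m : ℂ) ^ 2)⁻¹ else 0) := by
    funext m
    have : m % 3 = 0 ∨ m % 3 = 1 ∨ m % 3 = 2 := by omega
    rcases this with h | h | h
    · rw [if_pos (by omega), if_neg (by omega), if_neg (by omega)]; ring
    · rw [if_neg (by omega), if_pos (by omega), if_neg (by omega)]; ring
    · rw [if_neg (by omega), if_neg (by omega), if_pos (by omega)]; ring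
  rw [← e] at t
  have := t.unique pu_sq
  have hA : A = 4 * Real.pi ^ 2 / 27 := by linear_combination (1/2) * this
  rw [← hA]
  exact ⟨h1, h2⟩

lemma pu_inner (N a : ℤ) (hN : N ≠ 0) (A D E : ℂ)
    (hA : HasSum (fun j : ℤ => (((3 * j + a : ℤ) : ℂ) ^ 2)⁻¹) A)
    (hD : HasSum (fun j : ℤ => (3 * (j : ℂ) + a + N)⁻¹ - (3 * (j : ℂ) + a)⁻¹) D)
    (hE : HasSum (fun j : ℤ => (if 3 * j + a = 0 then ((N : ℂ) ^ 3)⁻¹ else 0)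
      + (if 3 * j + a = -N then 2 * ((N : ℂ) ^ 3)⁻¹ else 0)) E) :
    HasSum (fun m : ℤ => if (m - a) % 3 = 0 then puP N m else 0)
      ((N : ℂ)⁻¹ * A + ((N : ℂ) ^ 2)⁻¹ * D - E) := by
  rw [pu_reindex]
  refine pu_conv (((hA.mul_left ((N : ℂ)⁻¹)).add (hD.mul_left (((N : ℂ) ^ 2)⁻¹))).sub hE)
    (fun j => ?_) rfl
  rw [pu_pf N _ hN]
  push_cast
  ring

lemma pu_innerN (N : ℕ) (hN : N ≠ 0) :
    HasSum (fun m : ℤ => if (m - N) % 3 = 0 then puP N m else 0)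
      (4 * Real.pi ^ 2 / 27 * (N : ℂ)⁻¹
        - 2 * Real.pi / (3 * (Real.sqrt 3 : ℂ)) * (chiThree N * ((N : ℂ) ^ 2)⁻¹)
        - (if N % 3 = 0 then Real.pi ^ 2 / 9 * (N : ℂ)⁻¹ + 3 * ((N : ℂ) ^ 3)⁻¹ else 0)) := by
  have hN' : ((N : ℕ) : ℤ) ≠ 0 := by exact_mod_cast hN
  obtain ⟨k, hk⟩ : ∃ k, k = N / 3 := ⟨_, rfl⟩
  have h3 : N % 3 = 0 ∨ N % 3 = 1 ∨ N % 3 = 2 := by omega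
  have c := pu_cot
  rcases h3 with h | h | h
  · have hNk : N = 3 * k := by omega
    have hD := pu_telk 0 k
    have hE := (hasSum_ite_eq (0 : ℤ) (((N : ℂ) ^ 3)⁻¹)).add
      (hasSum_ite_eq (-k : ℤ) (2 * ((N : ℂ) ^ 3)⁻¹))
    have := pu_inner N 0 hN' _ _ _ pu_sq0 (by
      refine pu_conv hD (fun j => ?_) rfl
      rw [hNk]; push_cast; rfl) (by
      refine pu_conv hE (fun j => ?_) rfl
      congr 1
      · congr 1
        apply propext; omega
      · congr 1
        apply propext; omega)
    convert this using 1
    · funext m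
      congr 1
      apply propext; omega
    · simp [chiThree, h]
      ring
  · have hNk : N = 3 * k + 1 := by omega
    have hD := ((pu_telk 2 k).add (pu_tel (-1))).add c
    have := pu_inner N 1 hN' _ _ 0 pu_sq12.1 (by
      refine pu_conv hD (fun j => ?_) rfl
      rw [hNk]; push_cast; ring_nf) (by
      refine pu_conv hasSum_zero (fun j => ?_) rfl
      rw [if_neg (by omega), if_neg (by omega)]; simp)
    convert this using 1
    · funext m
      congr 1
      apply propext; omega
    · simp [chiThree, h]
      ring
  · have hNk : N = 3 * k + 2 := by omega
    have hD := (((pu_telk 4 k).add (pu_tel 1)).sub (pu_tel (-1))).sub c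
    have := pu_inner N 2 hN' _ _ 0 pu_sq12.2 (by
      refine pu_conv hD (fun j => ?_) rfl
      rw [hNk]; push_cast; ring_nf) (by
      refine pu_conv hasSum_zero (fun j => ?_) rfl
      rw [if_neg (by omega), if_neg (by omega)]; simp)
    convert this using 1
    · funext m
      congr 1
      apply propext; omega
    · simp [chiThree, h]
      ring

lemma pu_summ (s : ℕ) (hs : 1 < s) : Summable (fun n : ℕ => (((n + 1 : ℕ) : ℂ) ^ s)⁻¹) := by
  apply Summable.of_norm
  have h := ((Real.summable_one_div_nat_pow (p := s)).2 hs).comp_injective (add_left_injective 1)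
  refine h.congr fun m => ?_
  simp only [Function.comp, norm_inv, norm_pow, Complex.norm_natCast, one_div]

lemma pu_zeta (s : ℕ) (hs : 1 < s) :
    HasSum (fun n : ℕ => (((n + 1 : ℕ) : ℂ) ^ s)⁻¹) (riemannZeta s) := by
  have h := (pu_summ s hs).hasSum
  convert h using 1
  rw [zeta_eq_tsum_one_div_nat_add_one_cpow (by simpa using hs)]
  refine tsum_congr fun n => ?_
  simp

lemma pu_zeta3 (s : ℕ) (hs : 1 < s) :
    HasSum (fun n : ℕ => if (n + 1) % 3 = 0 then (((n + 1 : ℕ) : ℂ) ^ s)⁻¹ else 0)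
      ((3 ^ s)⁻¹ * riemannZeta s) := by
  have hi : Function.Injective (fun j : ℕ => 3 * j + 2) := fun x y h => by simpa using h
  rw [← hi.hasSum_iff]
  · refine pu_conv ((pu_zeta s hs).mul_left ((3 ^ s)⁻¹)) (fun j => ?_) rfl
    have : (3 * j + 2 + 1) % 3 = 0 := by omega
    simp only [Function.comp, this, if_true]
    rw [← mul_inv, ← mul_pow]
    push_cast
    ring
  · intro x hx
    rw [if_neg]
    intro h
    exact hx ⟨(x - 2) / 3, by simp only; omega⟩

lemma pu_L : HasSum (fun n : ℕ => chiThree (n + 1) * (((n + 1 : ℕ) : ℂ) ^ 4)⁻¹) (LChiThree 4) := by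
  have : Summable (fun n : ℕ => chiThree (n + 1) * (((n + 1 : ℕ) : ℂ) ^ 4)⁻¹) := by
    refine Summable.of_norm_bounded (pu_summ 4 (by norm_num)).norm fun n => ?_
    rw [norm_mul]
    refine mul_le_of_le_one_left (norm_nonneg _) ?_
    unfold chiThree
    split_ifs <;> simp
  convert this.hasSum using 1
  unfold LChiThree
  refine tsum_congr fun n => ?_
  push_cast
  rfl

noncomputable def puF (p : ℕ × ℤ) : ℂ :=
  (((p.1 + 1 : ℕ) : ℂ) ^ 2)⁻¹ *
    (if (p.2 - (p.1 + 1 : ℕ)) % 3 = 0 then puP (p.1 + 1 : ℕ) p.2 else 0)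

lemma pu_F_summable : Summable puF := by
  have h := (pu_summ 2 (by norm_num)).norm.mul_of_nonneg pu_summable_sq.norm
    (fun _ => norm_nonneg _) (fun _ => norm_nonneg _)
  refine Summable.of_norm_bounded h fun p => ?_
  unfold puF
  rw [norm_mul]
  refine mul_le_mul_of_nonneg_left ?_ (norm_nonneg _)
  split_ifs
  · exact pu_P_norm _ _
  · rw [norm_zero]; exact norm_nonneg _

lemma pu_total : ∑' p, puF p = -(1 / 81) * riemannZeta 5 + 35 * (Real.pi : ℂ) ^ 2 / 243 * riemannZeta 3
      - 2 * (Real.pi : ℂ) / (3 * (Real.sqrt 3 : ℂ)) * LChiThree 4 := by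
  have h := pu_F_summable.hasSum.prod_fiberwise
    (fun n => (pu_innerN (n + 1) (by omega)).mul_left ((((n + 1 : ℕ) : ℂ) ^ 2)⁻¹))
  have z3 := (pu_zeta 3 (by norm_num)).mul_left (4 * (Real.pi : ℂ) ^ 2 / 27)
  have w3 := (pu_zeta3 3 (by norm_num)).mul_left ((Real.pi : ℂ) ^ 2 / 9)
  have w5 := (pu_zeta3 5 (by norm_num)).mul_left 3
  have l := pu_L.mul_left (2 * (Real.pi : ℂ) / (3 * (Real.sqrt 3 : ℂ)))
  have t := ((z3.sub l).sub w3).sub w5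
  have := h.unique (by
    refine pu_conv t (fun n => ?_) rfl
    have : ((n + 1 : ℕ) : ℂ) ≠ 0 := by exact_mod_cast Nat.succ_ne_zero n
    generalize ((n + 1 : ℕ) : ℂ) = x at *
    split_ifs <;> ring_nf)
  rw [this]
  push_cast
  ring

lemma pu_split : ∑' p, puF p = ∑' p : ℕ × ℕ, puF (p.1, p.2 + 1) := by
  have i1 : Function.Injective (fun p : ℕ × ℕ => ((p.1, (p.2 : ℤ) + 1) : ℕ × ℤ)) := by
    rintro ⟨a, b⟩ ⟨c, d⟩ h
    simpa using h
  have i2 : Function.Injective (fun p : ℕ × ℕ => ((p.1, -((p.2 : ℤ) + 1)) : ℕ × ℤ)) := by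
    rintro ⟨a, b⟩ ⟨c, d⟩ h
    simpa using h
  have s1 : Summable (fun p : ℕ × ℕ => puF (p.1, (p.2 : ℤ) + 1)) := pu_F_summable.comp_injective i1
  have s2 : Summable (fun p : ℕ × ℕ => puF (p.1, -((p.2 : ℤ) + 1))) :=
    pu_F_summable.comp_injective i2
  have anti : ∑' p : ℕ × ℕ, puF (p.1, -((p.2 : ℤ) + 1)) = 0 := by
    have h := (Equiv.prodComm ℕ ℕ).tsum_eq (fun p : ℕ × ℕ => puF (p.1, -((p.2 : ℤ) + 1)))
    have h2 : ∑' p : ℕ × ℕ, puF (p.2, -((p.1 : ℤ) + 1))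
        = - ∑' p : ℕ × ℕ, puF (p.1, -((p.2 : ℤ) + 1)) := by
      rw [← tsum_neg]
      refine tsum_congr fun p => ?_
      obtain ⟨a, b⟩ := p
      simp only [puF, puP]
      by_cases hc : (-((b : ℤ) + 1) - (a + 1 : ℕ)) % 3 = 0
      · rw [if_pos hc, if_pos (by push_cast at *; omega)]
        push_cast
        have e : (-((b : ℂ) + 1) + (a + 1)) = -(-((a : ℂ) + 1) + (b + 1)) := by ring
        rw [e]
        simp only [mul_inv, inv_neg, neg_sq]
        ring
      · rw [if_neg hc, if_neg (by push_cast at *; omega)]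
        simp
    have h := h2.symm.trans h
    have : (2 : ℂ) * ∑' p : ℕ × ℕ, puF (p.1, -((p.2 : ℤ) + 1)) = 0 := by linear_combination -h
    simpa using this
  have z : ∀ n, puF (n, 0) = 0 := by intro n; simp [puF, puP]
  have f : ∀ n : ℕ, ∑' m : ℤ, puF (n, m) =
      ∑' m : ℕ, puF (n, (m : ℤ) + 1) + ∑' m : ℕ, puF (n, -((m : ℤ) + 1)) := by
    intro n
    rw [tsum_of_add_one_of_neg_add_one (f := fun m => puF (n, m)) (s1.prod_factor n)
      (s2.prod_factor n), z]
    simp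
  rw [pu_F_summable.tsum_prod, tsum_congr f, s1.prod.tsum_add s2.prod, ← s1.tsum_prod,
    ← s2.tsum_prod, anti, add_zero]

theorem zeta2_PU3_two_two_one :
    (∑' pr : ℕ × ℕ, (if (pr.1 + 1) % 3 = (pr.2 + 1) % 3 then
      (1 : ℂ) / (((pr.1 : ℂ) + 1) ^ 2 * ((pr.2 : ℂ) + 1) ^ 2
        * ((pr.1 : ℂ) + (pr.2 : ℂ) + 2)) else 0))
    = -(1 / 81) * riemannZeta 5 + 35 * (Real.pi : ℂ) ^ 2 / 243 * riemannZeta 3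
      - 2 * (Real.pi : ℂ) / (3 * (Real.sqrt 3 : ℂ)) * LChiThree 4 := by
  rw [← pu_total, pu_split]
  refine tsum_congr fun p => ?_
  obtain ⟨a, b⟩ := p
  simp only [puF, puP]
  by_cases hc : (a + 1) % 3 = (b + 1) % 3
  · rw [if_pos hc, if_pos (by push_cast; omega)]
    push_cast
    rw [one_div, ← mul_inv]
    congr 1
    ring
  · rw [if_neg hc, if_neg (by push_cast; omega), mul_zero]
end

section
/- Σ over integers m,n ≥ 1 with m ≡ n (mod 3) of 1/(m·(m+n)²) = (1/27)·ζ(3) + (π/(3√3))·L(2,χ₃). -/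
open Filter Topology Finset

noncomputable def cR (n : ℕ) : ℝ :=
  if n % 3 = 1 then 1 else if n % 3 = 2 then -1 else 0

noncomputable def wR (M i : ℕ) : ℝ := if (i + 1 + M) % 3 = 0 then 1 / ((i : ℝ) + 1) else 0

noncomputable def FR (p : ℕ × ℕ) : ℝ :=
  if (p.1 + 1) % 3 = (p.2 + 1) % 3 then
      (1 : ℝ) / (((p.1 : ℝ) + 1) * ((p.1 : ℝ) + (p.2 : ℝ) + 2) ^ 2) else 0

noncomputable def GR (p : ℕ × ℕ) : ℝ :=
  if (p.1 + 1) % 3 = (p.2 + 1) % 3 then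
      (1 : ℝ) / (((p.1 : ℝ) + 1) * ((p.2 : ℝ) + 1) * ((p.1 : ℝ) + (p.2 : ℝ) + 2)) else 0

lemma step_id (M K : ℕ) :
    (if M % 3 = (K + 1) % 3 then 1 / ((K : ℝ) + 1) - 1 / ((K : ℝ) + M + 1) else 0)
      = cR M * (cR (K + 1) / ((K : ℝ) + 1)) + wR M K - wR M (K + M) := by
  unfold cR wR
  have h1 : (K + M + 1 + M) % 3 = 0 ↔ M % 3 = (K + 1) % 3 := by omega
  have h2 : (K + 1 + M) % 3 = 0 ↔ (M % 3 + (K + 1) % 3) % 3 = 0 := by omega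
  simp only [h1, h2]
  push_cast
  have a1 : M % 3 = 0 ∨ M % 3 = 1 ∨ M % 3 = 2 := by omega
  have a2 : (K + 1) % 3 = 0 ∨ (K + 1) % 3 = 1 ∨ (K + 1) % 3 = 2 := by omega
  rcases a1 with a | a | a <;> rcases a2 with b | b | b <;> simp [a, b] <;> ring

lemma partial_id (M K : ℕ) :
    ∑ n ∈ range K, (if M % 3 = (n + 1) % 3 then 1 / ((n : ℝ) + 1) - 1 / ((n : ℝ) + M + 1) else 0)
      = cR M * (∑ n ∈ range K, cR (n + 1) / ((n : ℝ) + 1)) + ∑ i ∈ range M, wR M i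
        - ∑ i ∈ range M, wR M (K + i) := by
  induction K with
  | zero => simp
  | succ K ih =>
    rw [sum_range_succ, ih, step_id, sum_range_succ _ K]
    have h1 := sum_range_succ (fun i => wR M (K + i)) M
    have h2 := sum_range_succ' (fun i => wR M (K + i)) M
    have h3 : ∑ i ∈ range M, wR M (K + (i + 1)) = ∑ i ∈ range M, wR M (K + 1 + i) :=
      sum_congr rfl fun i _ => by congr 1; ring
    simp only [add_zero] at h2
    rw [h3] at h2
    linarith

lemma tail_tendsto (M : ℕ) :
    Tendsto (fun K : ℕ => ∑ i ∈ range M, wR M (K + i)) atTop (𝓝 0) := by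
  have : Tendsto (fun K : ℕ => ∑ i ∈ range M, wR M (K + i)) atTop (𝓝 (∑ i ∈ range M, (0:ℝ))) := by
    refine tendsto_finsetSum _ fun i _ => ?_
    have h : Tendsto (fun K : ℕ => wR M K) atTop (𝓝 0) := by
      refine squeeze_zero (fun K => ?_) (fun K => ?_) (tendsto_one_div_add_atTop_nhds_zero_nat (𝕜 := ℝ))
      · unfold wR; split_ifs <;> positivity
      · unfold wR; split_ifs
        · exact le_rfl
        · positivity
    exact h.comp (tendsto_add_atTop_nat i)
  simpa using this

lemma chi_partial (j : ℕ) : ∑ n ∈ range (3 * j + 1), cR (n + 1) / ((n : ℝ) + 1)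
    = 1 + (1 / 3) * ∑ i ∈ range j, (1 / ((1/3:ℝ) - (i + 1)) + 1 / ((1/3:ℝ) + (i + 1))) := by
  induction j with
  | zero => simp [cR]
  | succ j ih =>
    rw [show 3 * (j + 1) + 1 = (3 * j + 1) + 1 + 1 + 1 by ring, sum_range_succ, sum_range_succ,
      sum_range_succ, ih, sum_range_succ _ j]
    have e1 : cR (3 * j + 1 + 1) = -1 := by unfold cR; rw [if_neg (by omega), if_pos (by omega)]
    have e2 : cR (3 * j + 1 + 1 + 1) = 0 := by unfold cR; rw [if_neg (by omega), if_neg (by omega)]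
    have e3 : cR (3 * j + 1 + 1 + 1 + 1) = 1 := by unfold cR; rw [if_pos (by omega)]
    rw [e1, e2, e3]
    push_cast
    have n1 : (1/3:ℝ) - (j + 1) ≠ 0 := by
      have : (0:ℝ) ≤ j := by positivity
      linarith
    have n1' : (1:ℝ) - 3 * (j + 1) ≠ 0 := by
      have : (0:ℝ) ≤ j := by positivity
      linarith
    have k1 : 1 / ((1/3:ℝ) - (j + 1)) = - (3 / (3 * (j:ℝ) + 1 + 1)) := by
      rw [← neg_div, div_eq_div_iff n1 (by positivity)]; ring
    have k2 : 1 / ((1/3:ℝ) + (j + 1)) = 3 / (3 * (j:ℝ) + 1 + 1 + 1 + 1) := by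
      rw [div_eq_div_iff (by positivity) (by positivity)]; ring
    rw [k1, k2]
    ring

lemma chi_tendsto : Tendsto (fun j : ℕ => ∑ n ∈ range (3 * j + 1), cR (n + 1) / ((n : ℝ) + 1))
    atTop (𝓝 (Real.pi / (3 * Real.sqrt 3))) := by
  have hx : ((1/3 : ℝ) : ℂ) ∈ Complex.integerComplement := by
    rintro ⟨k, hk⟩
    have h : ((k : ℝ) : ℂ) = ((1/3 : ℝ) : ℂ) := by simpa using hk
    have h2 : (k : ℝ) = 1/3 := Complex.ofReal_injective h
    have h3 : (3 * k : ℝ) = 1 := by linarith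
    have h4 : 3 * k = 1 := by exact_mod_cast h3
    omega
  have h := tendsto_logDeriv_euler_cot_sub hx
  have hc : (Real.pi : ℂ) * Complex.cot (Real.pi * ((1/3 : ℝ) : ℂ)) - 1 / ((1/3 : ℝ) : ℂ)
      = ((Real.pi / Real.sqrt 3 - 3 : ℝ) : ℂ) := by
    have : Complex.cot (Real.pi * ((1/3 : ℝ) : ℂ)) = ((1 / Real.sqrt 3 : ℝ) : ℂ) := by
      rw [← Complex.ofReal_mul, ← Complex.ofReal_cot, Real.cot_eq_cos_div_sin,
        show Real.pi * (1/3) = Real.pi / 3 by ring, Real.cos_pi_div_three, Real.sin_pi_div_three]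
      congr 1
      field_simp
    rw [this]; push_cast; ring
  rw [hc] at h
  have h' : Tendsto (fun n : ℕ => ∑ i ∈ range n, (1 / ((1/3:ℝ) - (i + 1)) + 1 / ((1/3:ℝ) + (i + 1))))
      atTop (𝓝 (Real.pi / Real.sqrt 3 - 3)) := by
    have := (Complex.continuous_re.tendsto _).comp h
    rw [Complex.ofReal_re] at this
    refine this.congr fun n => ?_
    rw [Function.comp, ← Complex.ofReal_re (∑ i ∈ range n, _)]
    congr 1
    push_cast [cotTerm]
    rfl
  simp_rw [chi_partial]
  have h2 := (h'.const_mul (1/3)).const_add 1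
  convert h2 using 2
  field_simp
  ring

lemma FR_nonneg (p) : 0 ≤ FR p := by unfold FR; split_ifs <;> positivity

lemma FR_summable : Summable FR := by
  have hs : Summable fun n : ℕ => 1 / ((n : ℝ) + 1) ^ (3/2 : ℝ) := by
    have := (Real.summable_one_div_nat_add_rpow 1 (3/2)).2 (by norm_num)
    refine this.congr fun n => ?_
    rw [abs_of_nonneg (by positivity)]
  refine Summable.of_nonneg_of_le FR_nonneg (fun p => ?_)
    (hs.mul_of_nonneg hs (fun n => by positivity) (fun n => by positivity))
  obtain ⟨m, n⟩ := p
  unfold FR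
  simp only
  split_ifs
  · rw [← one_div_mul_one_div_rev, one_div_mul_one_div_rev, one_div_mul_one_div_rev]
    apply one_div_le_one_div_of_le (by positivity)
    have a : (0:ℝ) < (m:ℝ) + 1 := by positivity
    have b : (0:ℝ) < (n:ℝ) + 1 := by positivity
    have e : ((m:ℝ) + 1) ^ (3/2 : ℝ) = (m + 1) * ((m:ℝ) + 1) ^ (1/2 : ℝ) := by
      rw [← Real.rpow_one_add' a.le (by norm_num)]; norm_num
    have f : ((m:ℝ) + n + 2) ^ 2 = ((m:ℝ) + n + 2) ^ (1/2 : ℝ) * ((m:ℝ) + n + 2) ^ (3/2 : ℝ) := by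
      rw [← Real.rpow_add (by positivity)]; norm_num
    have g1 : ((m:ℝ) + 1) ^ (1/2 : ℝ) ≤ ((m:ℝ) + n + 2) ^ (1/2 : ℝ) :=
      Real.rpow_le_rpow a.le (by linarith) (by norm_num)
    have g2 : ((n:ℝ) + 1) ^ (3/2 : ℝ) ≤ ((m:ℝ) + n + 2) ^ (3/2 : ℝ) :=
      Real.rpow_le_rpow b.le (by linarith) (by norm_num)
    have := mul_le_mul_of_nonneg_left (mul_le_mul g1 g2 (by positivity) (by positivity)) a.le
    rw [f, e]
    linarith
  · positivity

lemma GR_eq (p : ℕ × ℕ) : GR p = FR p + FR p.swap := by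
  obtain ⟨m, n⟩ := p
  unfold GR FR
  simp only [Prod.swap, eq_comm (a := (n+1) % 3)]
  split_ifs
  · field_simp
    ring
  · simp

lemma GR_summable : Summable GR := by
  have := FR_summable.add ((Equiv.prodComm ℕ ℕ).summable_iff.2 FR_summable)
  exact this.congr fun p => by rw [GR_eq]; rfl

lemma GR_tsum : ∑' p, GR p = 2 * ∑' p, FR p := by
  have h2 := (Equiv.prodComm ℕ ℕ).tsum_eq FR
  have := FR_summable.tsum_add ((Equiv.prodComm ℕ ℕ).summable_iff.2 FR_summable)
  simp only [Function.comp] at this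
  rw [h2] at this
  rw [two_mul, ← this]
  exact tsum_congr fun p => by rw [GR_eq]; rfl

lemma inner_tsum (m : ℕ) : ∑' n, GR (m, n)
    = Real.pi / (3 * Real.sqrt 3) * (cR (m + 1) / ((m : ℝ) + 1) ^ 2)
      + 1 / ((m : ℝ) + 1) ^ 2 * ∑ i ∈ range (m + 1), wR (m + 1) i := by
  have hs : Summable fun n => GR (m, n) := GR_summable.prod_factor m
  have ht := hs.hasSum.tendsto_sum_nat
  have hj : Tendsto (fun j : ℕ => 3 * j + 1) atTop atTop :=
    tendsto_atTop_mono (fun j => by simp only [id]; omega) tendsto_id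
  have ht2 := ht.comp hj
  refine tendsto_nhds_unique ht2 ?_
  have h3 := (((chi_tendsto.const_mul (cR (m+1))).add_const (∑ i ∈ range (m + 1), wR (m + 1) i)).sub
    ((tail_tendsto (m+1)).comp hj)).const_mul (1 / ((m:ℝ)+1)^2)
  have hl : 1 / ((m:ℝ)+1)^2 * (cR (m + 1) * (Real.pi / (3 * Real.sqrt 3)) +
      ∑ i ∈ range (m + 1), wR (m + 1) i - 0) = Real.pi / (3 * Real.sqrt 3) * (cR (m + 1) / ((m : ℝ) + 1) ^ 2)
      + 1 / ((m : ℝ) + 1) ^ 2 * ∑ i ∈ range (m + 1), wR (m + 1) i := by ring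
  rw [hl] at h3
  refine h3.congr fun j => ?_
  simp only [Function.comp]
  rw [← partial_id, mul_sum]
  refine sum_congr rfl fun n _ => ?_
  unfold GR
  simp only
  split_ifs
  · push_cast
    field_simp
    ring
  · simp

noncomputable def AR (m : ℕ) : ℝ := 1 / ((m : ℝ) + 1) ^ 2 * ∑ i ∈ range m, wR (m + 1) i

lemma FR_antidiag (k : ℕ) : ∑ p ∈ antidiagonal k, FR p = AR (k + 1) := by
  rw [Finset.Nat.sum_antidiagonal_eq_sum_range_succ_mk, AR, mul_sum]
  refine sum_congr rfl fun i hi => ?_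
  have hi' : i ≤ k := by simpa [Nat.lt_succ_iff] using hi
  obtain ⟨l, rfl⟩ := Nat.exists_eq_add_of_le hi'
  unfold FR wR
  simp only [Nat.add_sub_cancel_left]
  have : (i + 1 + (i + l + 1 + 1)) % 3 = 0 ↔ (i + 1) % 3 = (l + 1) % 3 := by omega
  simp only [this]
  split_ifs
  · push_cast
    field_simp
    ring
  · simp

lemma AR_hasSum : HasSum AR (∑' p, FR p) := by
  have h := (Finset.HasAntidiagonal.sigmaAntidiagonalEquivProd (A := ℕ)).hasSum_iff.2 FR_summable.hasSum
  have h2 := h.sigma (g := fun k => AR (k+1)) (fun k => by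
    have := hasSum_fintype (fun c : antidiagonal k => FR c.1)
    rw [Finset.sum_coe_sort (antidiagonal k) FR, FR_antidiag] at this
    exact this)
  have h3 := (hasSum_nat_add_iff (f := AR) 1).1 h2
  simpa [AR] using h3

lemma sum_split (m : ℕ) : 1 / ((m : ℝ) + 1) ^ 2 * ∑ i ∈ range (m + 1), wR (m + 1) i
    = AR m + (if 3 ∣ m + 1 then 1 / ((m:ℝ) + 1) ^ 3 else 0) := by
  rw [sum_range_succ, AR, mul_add]
  congr 1
  unfold wR
  have : (m + 1 + (m + 1)) % 3 = 0 ↔ 3 ∣ m + 1 := by omega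
  simp only [this]
  split_ifs
  · field_simp
  · simp

lemma zeta_sum : HasSum (fun n : ℕ => 1 / ((n:ℝ) + 1) ^ 3) (∑' n : ℕ, 1 / ((n:ℝ) + 1) ^ 3) := by
  refine Summable.hasSum ?_
  have := (summable_nat_add_iff 1).2 (Real.summable_one_div_nat_pow.2 (by norm_num : 1 < 3))
  simpa using this

lemma three_sum : HasSum (fun m : ℕ => if 3 ∣ m + 1 then 1 / ((m:ℝ) + 1) ^ 3 else 0)
    (1 / 27 * ∑' n : ℕ, 1 / ((n:ℝ) + 1) ^ 3) := by
  have hinj : Function.Injective (fun n : ℕ => 3 * n + 2) := fun a b h => by simp at h; omega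
  rw [← hinj.hasSum_iff]
  · have hz := zeta_sum.mul_left (1/27)
    refine (congrArg (fun f : ℕ → ℝ => HasSum f
      (1 / 27 * ∑' n : ℕ, 1 / ((n:ℝ) + 1) ^ 3)) (funext fun n => ?_)).mpr hz
    have : 3 ∣ 3 * n + 2 + 1 := ⟨n + 1, by ring⟩
    simp only [Function.comp, if_pos this]
    push_cast
    rw [show (3 * (n:ℝ) + 2 + 1) = 3 * (n + 1) by ring]
    field_simp
    norm_num
  · intro x hx
    rw [if_neg]
    rintro ⟨c, hc⟩
    exact hx ⟨c - 1, by simp; omega⟩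

lemma chi2_sum : Summable (fun m : ℕ => cR (m + 1) / ((m : ℝ) + 1) ^ 2) := by
  have := (summable_nat_add_iff 1).2 (Real.summable_one_div_nat_pow.2 (by norm_num : 1 < 2))
  refine Summable.of_norm_bounded this fun m => ?_
  rw [norm_div, Real.norm_of_nonneg (by positivity : 0 ≤ ((m:ℝ)+1)^2)]
  push_cast
  gcongr
  unfold cR
  split_ifs <;> simp

lemma main_real : ∑' p, FR p = 1 / 27 * ∑' n : ℕ, 1 / ((n:ℝ) + 1) ^ 3
    + Real.pi / (3 * Real.sqrt 3) * ∑' m : ℕ, cR (m + 1) / ((m : ℝ) + 1) ^ 2 := by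
  have h1 := GR_summable.tsum_prod
  rw [GR_tsum] at h1
  have h2 := ((chi2_sum.hasSum.mul_left (Real.pi / (3 * Real.sqrt 3))).add
    (AR_hasSum.add three_sum)).tsum_eq
  simp_rw [inner_tsum, sum_split] at h1
  rw [h2] at h1
  linarith

/-- The sum over m,n ≥ 1 with m ≡ n (mod 3) of 1/(m(m+n)²) equals
(1/27)ζ(3) + (π/(3√3))L(2,χ₃). -/
theorem partial_double_zeta_value :
    (∑' pr : ℕ × ℕ, (if (pr.1 + 1) % 3 = (pr.2 + 1) % 3 then
      (1 : ℂ) / (((pr.1 : ℂ) + 1)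
        * ((pr.1 : ℂ) + (pr.2 : ℂ) + 2) ^ 2) else 0))
    = 1 / 27 * riemannZeta 3
      + (Real.pi : ℂ) / (3 * (Real.sqrt 3 : ℂ)) * LChiThree 2 := by
  have h := congrArg (fun x : ℝ => (x : ℂ)) main_real
  push_cast at h
  have hz : riemannZeta 3 = ∑' n : ℕ, 1 / ((n:ℂ) + 1) ^ 3 := by
    rw [zeta_eq_tsum_one_div_nat_add_one_cpow (by norm_num)]
    norm_cast
  rw [hz]
  convert h using 1
  · refine tsum_congr fun p => ?_
    unfold FR
    split_ifs <;> push_cast <;> rfl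
  · congr 2
    unfold LChiThree
    refine tsum_congr fun n => ?_
    congr 1
    unfold chiThree cR
    split_ifs <;> simp
end

section
/- Σ over integers m,n ≥ 1 with m odd of 1/(m²·n·(m+n)·(m+2n)) = (3/8)·ζ(2)·ζ(3) − (31/64)·ζ(5), and Σ over integers m,n ≥ 1 with m odd of 1/(m·n²·(m+n)²·(m+2n)²) = (827/64)·ζ(5)·ζ(2) − (1397/64)·ζ(7). -/
open Filter Topology

/-- Parity indicator: 1 when j + b is even. -/
noncomputable def cpar (b j : ℤ) : ℝ := if (j + b) % 2 = 0 then 1 else 0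

lemma cpar_cases (b j : ℤ) : cpar b j = 0 ∨ cpar b j = 1 := by
  unfold cpar; split_ifs <;> simp

lemma cpar_congr (b i j : ℤ) (h : (i - j) % 2 = 0) : cpar b i = cpar b j := by
  unfold cpar
  have : (i + b) % 2 = 0 ↔ (j + b) % 2 = 0 := by omega
  simp [this]

lemma hs_cg {ι : Type*} {f g : ι → ℝ} {a b : ℝ} (h : HasSum f a) (hfg : ∀ x, g x = f x)
    (hab : b = a) : HasSum g b := by
  have : g = f := funext hfg
  rw [this, hab]; exact h

lemma telesc (k : ℤ → ℝ) (hs : Summable fun p => k p - k (p + 1))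
    (h1 : Tendsto (fun n : ℕ => k n) atTop (𝓝 0))
    (h2 : Tendsto (fun n : ℕ => k (-n)) atTop (𝓝 0)) :
    HasSum (fun p => k p - k (p + 1)) 0 := by
  have a1 : HasSum (fun n : ℕ => k n - k (n + 1)) (k 0 - 0) := by
    refine (Summable.hasSum_iff_tendsto_nat (hs.comp_injective Nat.cast_injective)).2 ?_
    simp only [Function.comp]
    have : ∀ N : ℕ, ∑ i ∈ Finset.range N, (k i - k (i + 1)) = k 0 - k N := by
      intro N
      have := Finset.sum_range_sub' (fun i : ℕ => k i) N
      push_cast at this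
      simpa using this
    simp only [this]
    exact tendsto_const_nhds.sub h1
  have a2 : HasSum (fun n : ℕ => k (-(n + 1)) - k (-(n + 1) + 1)) (0 - k 0) := by
    refine (Summable.hasSum_iff_tendsto_nat (hs.comp_injective
      (i := fun n : ℕ => (-(n + 1) : ℤ)) (by intro a b; simp))).2 ?_
    simp only [Function.comp]
    have : ∀ N : ℕ, ∑ i ∈ Finset.range N, (k (-(i + 1)) - k (-(i + 1) + 1)) = k (-N) - k 0 := by
      intro N
      have := Finset.sum_range_sub (fun i : ℕ => k (-i)) N
      push_cast at this
      simpa using this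
    simp only [this]
    exact h2.sub tendsto_const_nhds
  have := HasSum.of_nat_of_neg_add_one (f := fun p => k p - k (p + 1)) a1 a2
  simpa using this

noncomputable def hpar (b j : ℤ) : ℝ := cpar b j / j

lemma abs_cpar_le (b j : ℤ) : |cpar b j| ≤ 1 := by
  rcases cpar_cases b j with h | h <;> simp [h]

lemma abs_hpar_le (b j : ℤ) : |hpar b j| ≤ |(1 : ℝ) / j| := by
  unfold hpar
  rw [abs_div, abs_div]
  refine div_le_div_of_nonneg_right ?_ (abs_nonneg _)
  rw [abs_one]; exact abs_cpar_le b j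

lemma summ_sq : Summable fun j : ℤ => ((1 : ℝ) / j) ^ 2 := by
  have := (Real.summable_one_div_int_pow (p := 2)).2 (by norm_num)
  simpa [div_pow] using this

lemma summ_inv_sub : Summable fun p : ℤ => (1 : ℝ) / p - 1 / (p + 2 : ℤ) := by
  have h2 : Summable fun j : ℤ => ((1 : ℝ) / (j + 2 : ℤ)) ^ 2 :=
    (Equiv.addRight (2 : ℤ)).summable_iff.2 summ_sq
  have h0 : Summable fun p : ℤ => if p = 0 then (1 : ℝ) else 0 := (hasSum_ite_eq _ _).summable
  have h3 : Summable fun p : ℤ => if p = -2 then (1 : ℝ) else 0 := (hasSum_ite_eq _ _).summable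
  refine Summable.of_norm_bounded ((summ_sq.add h2).add (h0.add h3)) ?_
  intro p
  have e1 := sq_nonneg ((1 : ℝ) / p)
  have e2 := sq_nonneg ((1 : ℝ) / (p + 2 : ℤ))
  by_cases hp : p = 0
  · subst hp; norm_num
  by_cases hq : p = -2
  · subst hq; norm_num
  have hp' : (p : ℝ) ≠ 0 := by exact_mod_cast hp
  have hq' : ((p + 2 : ℤ) : ℝ) ≠ 0 := by
    have : p + 2 ≠ 0 := by omega
    exact_mod_cast this
  have : (1 : ℝ) / p - 1 / (p + 2 : ℤ) = 2 * (1 / p) * (1 / (p + 2 : ℤ)) := by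
    field_simp; push_cast; ring
  rw [this]
  simp only [hp, hq, if_false, Real.norm_eq_abs]
  rw [abs_le]
  constructor <;> nlinarith [sq_nonneg ((1 : ℝ) / p - 1 / (p + 2 : ℤ)), sq_nonneg ((1 : ℝ) / p + 1 / (p + 2 : ℤ))]

lemma tend_h1 (b a : ℤ) : Tendsto (fun n : ℕ => hpar b (n + a)) atTop (𝓝 0) := by
  have : Tendsto (fun n : ℕ => |(1 : ℝ) / ((n + a : ℤ) : ℝ)|) atTop (𝓝 0) := by
    have : Tendsto (fun n : ℕ => (1 : ℝ) / ((n + a : ℤ) : ℝ)) atTop (𝓝 0) := by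
      push_cast
      exact tendsto_const_nhds.div_atTop (tendsto_natCast_atTop_atTop.atTop_add tendsto_const_nhds)
    simpa using this.abs
  exact squeeze_zero_norm (fun n => abs_hpar_le b _) this

lemma tend_h2 (b a : ℤ) : Tendsto (fun n : ℕ => hpar b (-n + a)) atTop (𝓝 0) := by
  have : Tendsto (fun n : ℕ => |(1 : ℝ) / ((-n + a : ℤ) : ℝ)|) atTop (𝓝 0) := by
    have : Tendsto (fun n : ℕ => (1 : ℝ) / ((n + (-a) : ℤ) : ℝ)) atTop (𝓝 0) := by
      push_cast
      exact tendsto_const_nhds.div_atTop (tendsto_natCast_atTop_atTop.atTop_add tendsto_const_nhds)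
    have h := this.abs
    simp only [abs_zero] at h
    refine h.congr fun n => ?_
    rw [abs_div, abs_div, ← abs_neg ((n + (-a) : ℤ) : ℝ)]
    congr 2; push_cast; ring
  exact squeeze_zero_norm (fun n => abs_hpar_le b _) this

lemma hasSum_step2 (b : ℤ) : HasSum (fun p : ℤ => hpar b p - hpar b (p + 2)) 0 := by
  have key := telesc (fun p => hpar b p + hpar b (p + 1)) ?_ ?_ ?_
  · refine hs_cg key (fun p => ?_) rfl
    have : p + 1 + 1 = p + 2 := by ring
    rw [this]; ring
  · have : Summable fun p : ℤ => hpar b p - hpar b (p + 2) := by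
      refine Summable.of_norm_bounded summ_inv_sub.abs ?_
      intro p
      have : hpar b p - hpar b (p + 2) = cpar b p * ((1 : ℝ) / p - 1 / (p + 2 : ℤ)) := by
        unfold hpar
        rw [cpar_congr b (p + 2) p (by omega)]; ring
      rw [this, norm_mul]
      exact mul_le_of_le_one_left (abs_nonneg _) (abs_cpar_le b p)
    refine this.congr fun p => ?_
    have : p + 1 + 1 = p + 2 := by ring
    rw [this]; ring
  · simpa using (tend_h1 b 0).add (tend_h1 b 1)
  · simpa using (tend_h2 b 0).add (tend_h2 b 1)

lemma hasSum_step (b : ℤ) (a : ℕ) : HasSum (fun p : ℤ => hpar b p - hpar b (p + 2 * a)) 0 := by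
  induction a with
  | zero => simp
  | succ a ih =>
    have h := (Equiv.addRight (2 * a : ℤ)).hasSum_iff.2 (hasSum_step2 b)
    have h2 := ih.add h
    simp only [add_zero] at h2
    convert h2 using 2 with p
    simp only [Function.comp, Equiv.coe_addRight]
    have : p + 2 * ((a + 1 : ℕ) : ℤ) = p + 2 * a + 2 := by push_cast; ring
    rw [this]; ring

lemma hasSum_sym (b : ℤ) (a : ℕ) : HasSum (fun p : ℤ => hpar b (p - a) - hpar b (p + a)) 0 := by
  have h := (Equiv.subRight (a : ℤ)).hasSum_iff.2 (hasSum_step b a)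
  refine hs_cg h (fun p => ?_) rfl
  have : p + a = p - a + 2 * a := by ring
  rw [this]; rfl

/-- real zeta -/
noncomputable def Zr (s : ℕ) : ℝ := ∑' n : ℕ, 1 / ((n : ℝ) + 1) ^ s

lemma Zr_hasSum (s : ℕ) (hs : 1 < s) : HasSum (fun n : ℕ => 1 / ((n : ℝ) + 1) ^ s) (Zr s) := by
  have h := (summable_nat_add_iff 1).2 (Real.summable_one_div_nat_pow.2 hs)
  push_cast at h
  exact h.hasSum

lemma Zr_eq (s : ℕ) (hs : 1 < s) : riemannZeta s = (Zr s : ℂ) := by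
  rw [zeta_nat_eq_tsum_of_gt_one hs, Zr, Complex.ofReal_tsum]
  rw [Summable.tsum_eq_zero_add]
  · have : s ≠ 0 := by omega
    simp [this]
  · have := Real.summable_one_div_nat_pow.2 hs
    have h2 := Complex.summable_ofReal.2 this
    simpa using h2

lemma Zr_even (s : ℕ) (hs : 1 < s) :
    HasSum (fun n : ℕ => cpar 0 (n + 1) / ((n : ℝ) + 1) ^ s) (Zr s / 2 ^ s) := by
  have hi : Function.Injective (fun n : ℕ => 2 * n + 1) := by intro a b; simp
  rw [← hi.hasSum_iff]
  · have := (Zr_hasSum s hs).div_const (2 ^ s)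
    refine hs_cg this (fun n => ?_) rfl
    have : cpar 0 (((2 * n + 1 : ℕ) : ℤ) + 1) = 1 := by
      unfold cpar; rw [if_pos]; push_cast; omega
    simp only [Function.comp, this]
    rw [div_div, ← mul_pow]; push_cast; ring_nf
  · intro x hx
    have : cpar 0 ((x : ℤ) + 1) = 0 := by
      unfold cpar; rw [if_neg]
      intro h; apply hx
      exact ⟨(x - 1) / 2, by simp only; omega⟩
    simp [this]

lemma cpar_one (j : ℤ) : cpar 1 j = 1 - cpar 0 j := by
  unfold cpar
  by_cases h : (j + 1) % 2 = 0
  · have : ¬ ((j + 0) % 2 = 0) := by omega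
    simp only [h, this]; norm_num
  · have : ((j + 0) % 2 = 0) := by omega
    simp only [h, this]; norm_num

lemma Zr_odd (s : ℕ) (hs : 1 < s) :
    HasSum (fun n : ℕ => cpar 1 (n + 1) / ((n : ℝ) + 1) ^ s) (Zr s - Zr s / 2 ^ s) := by
  have := (Zr_hasSum s hs).sub (Zr_even s hs)
  refine hs_cg this (fun n => ?_) rfl
  rw [cpar_one]; ring

lemma hpar_sq_hasSum (b : ℤ) (P : ℝ) (h : HasSum (fun n : ℕ => cpar b (n + 1) / ((n : ℝ) + 1) ^ 2) P) :
    HasSum (fun j : ℤ => hpar b j ^ 2) (2 * P) := by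
  have h1 : HasSum (fun n : ℕ => hpar b (n + 1) ^ 2) P := by
    convert h using 2 with n
    unfold hpar
    rcases cpar_cases b (n + 1) with h | h <;> simp [h]
  have h2 : HasSum (fun n : ℕ => hpar b (-(n + 1)) ^ 2) P := by
    convert h1 using 2 with n
    unfold hpar
    rw [cpar_congr b (-(n + 1)) (n + 1) (by omega)]; push_cast
    rw [div_neg, neg_sq]
  have := HasSum.of_add_one_of_neg_add_one (f := fun j => hpar b j ^ 2) h1 h2
  convert this using 1
  simp [hpar]; ring

lemma half_sum (F : ℤ → ℝ) (hF : ∀ p, F (-p) = F p) (S : ℝ) (h : HasSum F S) :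
    HasSum (fun n : ℕ => F (n + 1)) ((S - F 0) / 2) := by
  have h1 := h.nat_add_neg
  have h2 := (hasSum_nat_add_iff' 1).2 h1
  have h3 := h2.div_const 2
  simp only [hF] at h3
  refine hs_cg h3 (fun n => ?_) ?_
  · push_cast; ring
  · simp

lemma cpar_pm (b p : ℤ) (n : ℕ) : cpar b (p + n) = cpar b (p - n) :=
  cpar_congr _ _ _ (by omega)

lemma F1_sum (b : ℤ) (n : ℕ) (hn : n ≠ 0) :
    HasSum (fun p : ℤ => cpar b (p - n) / ((p : ℝ) ^ 2 - (n : ℝ) ^ 2))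
      (cpar b 0 / (2 * (n : ℝ) ^ 2)) := by
  have hn' : (n : ℝ) ≠ 0 := by exact_mod_cast hn
  have h0 := (hasSum_sym b n).mul_left (1 / (2 * (n : ℝ)))
  have h1 := hasSum_ite_eq (n : ℤ) (cpar b 0 / (4 * (n : ℝ) ^ 2))
  have h2 := hasSum_ite_eq (-n : ℤ) (cpar b 0 / (4 * (n : ℝ) ^ 2))
  refine hs_cg ((h0.add h1).add h2) (fun p => ?_) (by field_simp; ring)
  by_cases hp : p = n
  · subst hp
    have e : ¬ ((n : ℤ) = -n) := by omega
    have e2 : cpar b ((n : ℤ) + n) = cpar b 0 := cpar_congr _ _ _ (by omega)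
    simp only [if_pos, if_neg e, hpar, e2]
    simp
    field_simp
    ring
  by_cases hq : p = -n
  · subst hq
    have e : ¬ (-(n : ℤ) = n) := by omega
    have e2 : cpar b (-(n : ℤ) - n) = cpar b 0 := cpar_congr _ _ _ (by omega)
    simp only [if_pos, if_neg e, hpar, e2]
    simp
    field_simp
    ring
  have a1 : (p : ℝ) - n ≠ 0 := by
    have : p - n ≠ 0 := by omega
    exact_mod_cast this
  have a2 : (p : ℝ) + n ≠ 0 := by
    have : p + n ≠ 0 := by omega
    exact_mod_cast this
  have a3 : (p : ℝ) ^ 2 - (n : ℝ) ^ 2 = (p - n) * (p + n) := by ring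
  simp only [if_neg hp, if_neg hq, hpar, cpar_pm, a3]
  push_cast
  field_simp
  ring

set_option maxHeartbeats 1600000 in
lemma F2_sum (b : ℤ) (n : ℕ) (hn : n ≠ 0) (Q : ℝ) (hQ : HasSum (fun j : ℤ => hpar b j ^ 2) Q) :
    HasSum (fun p : ℤ => cpar b (p - n) / ((p : ℝ) ^ 2 - (n : ℝ) ^ 2) ^ 2)
      (Q / (2 * (n : ℝ) ^ 2) - 3 * cpar b 0 / (8 * (n : ℝ) ^ 4)) := by
  have hn' : (n : ℝ) ≠ 0 := by exact_mod_cast hn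
  have q1 : HasSum (fun p : ℤ => hpar b (p - n) ^ 2) Q := (Equiv.subRight (n : ℤ)).hasSum_iff.2 hQ
  have q2 : HasSum (fun p : ℤ => hpar b (p + n) ^ 2) Q := (Equiv.addRight (n : ℤ)).hasSum_iff.2 hQ
  have h0 := (q1.add q2).mul_left (1 / (4 * (n : ℝ) ^ 2))
  have h3 := (F1_sum b n hn).mul_left (1 / (2 * (n : ℝ) ^ 2))
  have h1 := hasSum_ite_eq (n : ℤ) (cpar b 0 / (16 * (n : ℝ) ^ 4))
  have h2 := hasSum_ite_eq (-n : ℤ) (cpar b 0 / (16 * (n : ℝ) ^ 4))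
  refine hs_cg (((h0.sub h3).sub h1).sub h2) (fun p => ?_) (by field_simp; ring)
  have sq0 : cpar b 0 ^ 2 = cpar b 0 := by rcases cpar_cases b 0 with h | h <;> simp [h]
  by_cases hp : p = n
  · subst hp
    have e : ¬ ((n : ℤ) = -n) := by omega
    have e2 : cpar b ((n : ℤ) + n) = cpar b 0 := cpar_congr _ _ _ (by omega)
    simp only [if_pos, if_neg e, hpar, e2, div_pow, sq0]
    simp
    field_simp
    ring
  by_cases hq : p = -n
  · subst hq
    have e : ¬ (-(n : ℤ) = n) := by omega
    have e2 : cpar b (-(n : ℤ) - n) = cpar b 0 := cpar_congr _ _ _ (by omega)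
    simp only [if_pos, if_neg e, hpar, e2, div_pow, sq0]
    simp
    field_simp
    ring
  have a1 : (p : ℝ) - n ≠ 0 := by
    have : p - n ≠ 0 := by omega
    exact_mod_cast this
  have a2 : (p : ℝ) + n ≠ 0 := by
    have : p + n ≠ 0 := by omega
    exact_mod_cast this
  have a3 : (p : ℝ) ^ 2 - (n : ℝ) ^ 2 = (p - n) * (p + n) := by ring
  simp only [if_neg hp, if_neg hq, hpar, cpar_pm, a3]
  push_cast
  rcases cpar_cases b (p - n) with h | h <;> simp only [h]
  · simp
  · field_simp
    ring

lemma F1_half (b : ℤ) (n : ℕ) (hn : n ≠ 0) :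
    HasSum (fun p : ℕ => cpar b ((p : ℤ) + 1 - n) / (((p : ℝ) + 1) ^ 2 - (n : ℝ) ^ 2))
      (cpar b 0 / (4 * (n : ℝ) ^ 2) + cpar b n / (2 * (n : ℝ) ^ 2)) := by
  have h := half_sum _ (fun p => ?_) _ (F1_sum b n hn)
  · refine hs_cg h (fun p => ?_) ?_
    · push_cast; rfl
    · rw [cpar_congr b (0 - n) n (by omega)]
      have hn' : (n : ℝ) ≠ 0 := by exact_mod_cast hn
      push_cast; field_simp; ring
  · rw [cpar_congr b (-p - n) (p - n) (by omega)]; push_cast; ring_nf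

lemma F2_half (b : ℤ) (n : ℕ) (hn : n ≠ 0) (Q : ℝ) (hQ : HasSum (fun j : ℤ => hpar b j ^ 2) Q) :
    HasSum (fun p : ℕ => cpar b ((p : ℤ) + 1 - n) / (((p : ℝ) + 1) ^ 2 - (n : ℝ) ^ 2) ^ 2)
      (Q / (4 * (n : ℝ) ^ 2) - 3 * cpar b 0 / (16 * (n : ℝ) ^ 4) - cpar b n / (2 * (n : ℝ) ^ 4)) := by
  have h := half_sum _ (fun p => ?_) _ (F2_sum b n hn Q hQ)
  · refine hs_cg h (fun p => ?_) ?_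
    · push_cast; rfl
    · rw [cpar_congr b (0 - n) n (by omega)]
      have hn' : (n : ℝ) ≠ 0 := by exact_mod_cast hn
      push_cast; field_simp; ring
  · rw [cpar_congr b (-p - n) (p - n) (by omega)]; push_cast; ring_nf

lemma F3_half (b : ℤ) (n : ℕ) (hn : n ≠ 0) (Q P : ℝ) (hQ : HasSum (fun j : ℤ => hpar b j ^ 2) Q)
    (hP : HasSum (fun p : ℕ => cpar b ((p : ℤ) + 1 - n) / ((p : ℝ) + 1) ^ 2) P) :
    HasSum (fun p : ℕ => cpar b ((p : ℤ) + 1 - n) /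
        (((p : ℝ) + 1) ^ 2 * (((p : ℝ) + 1) ^ 2 - (n : ℝ) ^ 2) ^ 2))
      (P / n ^ 4 + Q / (4 * (n : ℝ) ^ 4) - 23 * cpar b 0 / (16 * (n : ℝ) ^ 6)
        - cpar b n / (n : ℝ) ^ 6) := by
  have hn' : (n : ℝ) ≠ 0 := by exact_mod_cast hn
  have h1 := (F1_half b n hn).mul_left (1 / (n : ℝ) ^ 4)
  have h2 := (F2_half b n hn Q hQ).mul_left (1 / (n : ℝ) ^ 2)
  have h3 := hasSum_ite_eq (n - 1 : ℕ) (cpar b 0 / (n : ℝ) ^ 6)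
  have h4 := hP.mul_left (1 / (n : ℝ) ^ 4)
  refine hs_cg (((h4.sub h3).sub h1).add h2) (fun p => ?_) (by field_simp; ring)
  have hp0 : (p : ℝ) + 1 ≠ 0 := by positivity
  by_cases hp : p = n - 1
  · have e : (n : ℝ) = p + 1 := by
      have : n = p + 1 := by omega
      exact_mod_cast this
    have e2 : (p : ℤ) + 1 - n = 0 := by omega
    simp only [if_pos hp, e, e2]
    simp
    field_simp
    ring
  have a1 : (p : ℝ) + 1 - n ≠ 0 := by
    have : (p : ℤ) + 1 - n ≠ 0 := by omega
    exact_mod_cast this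
  have a2 : (p : ℝ) + 1 + n ≠ 0 := by positivity
  have a3 : ((p : ℝ) + 1) ^ 2 - (n : ℝ) ^ 2 = (p + 1 - n) * (p + 1 + n) := by ring
  simp only [if_neg hp, a3]
  field_simp
  ring

lemma P_odd (n : ℕ) :
    HasSum (fun p : ℕ => cpar 1 ((p : ℤ) + 1 - n) / ((p : ℝ) + 1) ^ 2)
      (3 / 4 * Zr 2 - cpar 1 n * Zr 2 / 2) := by
  rcases Int.emod_two_eq_zero_or_one n with h | h
  · refine hs_cg (Zr_odd 2 (by norm_num)) (fun p => ?_) ?_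
    · rw [cpar_congr 1 (p + 1 - n) (p + 1) (by omega)]
    · have : cpar 1 n = 0 := by unfold cpar; rw [if_neg]; omega
      rw [this]; ring
  · refine hs_cg (Zr_even 2 (by norm_num)) (fun p => ?_) ?_
    · have : cpar 1 ((p : ℤ) + 1 - n) = cpar 0 (p + 1) := by
        unfold cpar
        have : ((p : ℤ) + 1 - n + 1) % 2 = 0 ↔ ((p : ℤ) + 1 + 0) % 2 = 0 := by omega
        simp only [this]
      rw [this]
    · have : cpar 1 n = 1 := by unfold cpar; rw [if_pos]; omega
      rw [this]; ring

lemma Q_odd : HasSum (fun j : ℤ => hpar 1 j ^ 2) (3 / 2 * Zr 2) :=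
  hs_cg (hpar_sq_hasSum 1 _ (Zr_odd 2 (by norm_num))) (fun _ => rfl) (by ring)

lemma Q_even : HasSum (fun j : ℤ => hpar 0 j ^ 2) (1 / 2 * Zr 2) :=
  hs_cg (hpar_sq_hasSum 0 _ (Zr_even 2 (by norm_num))) (fun _ => rfl) (by ring)

lemma double_nonneg {f : ℕ × ℕ → ℝ} (hf : 0 ≤ f) {g : ℕ → ℝ} {s : ℝ}
    (h1 : ∀ n, HasSum (fun p => f (n, p)) (g n)) (h2 : HasSum g s) : HasSum f s := by
  have hs : Summable f := by
    rw [summable_prod_of_nonneg hf]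
    refine ⟨fun n => (h1 n).summable, ?_⟩
    simp only [(h1 _).tsum_eq]
    exact h2.summable
  have := hs.hasSum.prod_fiberwise h1
  rw [h2.unique this]
  exact hs.hasSum

lemma pair_sum {F : ℕ × ℕ → ℝ} {s : ℝ} (h : HasSum F s) (hd : ∀ x, F (x, x) = 0) :
    HasSum (fun q : ℕ × ℕ => F (q.2, q.1 + q.2 + 1) + F (q.1 + q.2 + 1, q.2)) s := by
  let Φ : (ℕ × ℕ) ⊕ (ℕ × ℕ) → ℕ × ℕ :=
    Sum.elim (fun q => (q.2, q.1 + q.2 + 1)) (fun q => (q.1 + q.2 + 1, q.2))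
  have hi : Function.Injective Φ := by
    rintro (⟨a, b⟩ | ⟨a, b⟩) (⟨c, d⟩ | ⟨c, d⟩) h <;> simp [Φ] at h ⊢ <;> omega
  have h' : HasSum (F ∘ Φ) s := by
    rw [hi.hasSum_iff]
    · exact h
    · rintro ⟨a, b⟩ hx
      rcases lt_trichotomy a b with hab | hab | hab
      · exact absurd ⟨Sum.inl (b - a - 1, a), by simp [Φ]; omega⟩ hx
      · subst hab; exact hd a
      · exact absurd ⟨Sum.inr (a - b - 1, b), by simp [Φ]; omega⟩ hx
  have s1 : Summable (fun q : ℕ × ℕ => F (q.2, q.1 + q.2 + 1)) :=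
    h'.summable.comp_injective Sum.inl_injective
  have s2 : Summable (fun q : ℕ × ℕ => F (q.1 + q.2 + 1, q.2)) :=
    h'.summable.comp_injective Sum.inr_injective
  have h3 := HasSum.sum (f := F ∘ Φ) s1.hasSum s2.hasSum
  rw [h'.unique h3]
  exact s1.hasSum.add s2.hasSum

lemma cpar_nonneg (b j : ℤ) : 0 ≤ cpar b j := by
  rcases cpar_cases b j with h | h <;> simp [h]

lemma D1 : HasSum (fun q : ℕ × ℕ => (1 / ((q.1 : ℝ) + 1)) *
      (cpar 1 ((q.2 : ℤ) + 1 - (q.1 + 1 : ℕ)) / (((q.2 : ℝ) + 1) ^ 2 - ((q.1 + 1 : ℕ) : ℝ) ^ 2) ^ 2))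
    (3 / 8 * Zr 2 * Zr 3 - 31 / 64 * Zr 5) := by
  refine double_nonneg (fun q => ?_)
    (fun n => (F2_half 1 (n + 1) (by omega) _ Q_odd).mul_left (1 / ((n : ℝ) + 1))) ?_
  · exact mul_nonneg (by positivity) (div_nonneg (cpar_nonneg _ _) (by positivity))
  · have h := ((Zr_hasSum 3 (by norm_num)).mul_left (3 / 8 * Zr 2)).sub
      ((Zr_odd 5 (by norm_num)).mul_left (1 / 2))
    refine hs_cg h (fun n => ?_) (by ring)
    have c0 : cpar 1 0 = 0 := by norm_num [cpar]
    rw [c0]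
    push_cast
    field_simp
    ring

lemma D2 : HasSum (fun q : ℕ × ℕ => (1 / ((q.1 : ℝ) + 1)) *
      (cpar 1 ((q.2 : ℤ) + 1 - (q.1 + 1 : ℕ)) /
        (((q.2 : ℝ) + 1) ^ 2 * (((q.2 : ℝ) + 1) ^ 2 - ((q.1 + 1 : ℕ) : ℝ) ^ 2) ^ 2)))
    (41 / 64 * Zr 2 * Zr 5 - 127 / 128 * Zr 7) := by
  refine double_nonneg (fun q => ?_)
    (fun n => (F3_half 1 (n + 1) (by omega) _ _ Q_odd (P_odd (n + 1))).mul_left (1 / ((n : ℝ) + 1))) ?_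
  · exact mul_nonneg (by positivity) (div_nonneg (cpar_nonneg _ _) (by positivity))
  · have h := (((Zr_hasSum 5 (by norm_num)).mul_left (9 / 8 * Zr 2)).sub
      ((Zr_odd 5 (by norm_num)).mul_left (1 / 2 * Zr 2))).sub (Zr_odd 7 (by norm_num))
    refine hs_cg h (fun n => ?_) (by ring)
    have c0 : cpar 1 0 = 0 := by norm_num [cpar]
    rw [c0]
    push_cast
    field_simp
    ring

lemma D3 : HasSum (fun q : ℕ × ℕ => (16 * cpar 1 (q.1 + 1) / ((q.1 : ℝ) + 1)) *
      (cpar 0 ((q.2 : ℤ) + 1 - (q.1 + 1 : ℕ)) /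
        (((q.2 : ℝ) + 1) ^ 2 * (((q.2 : ℝ) + 1) ^ 2 - ((q.1 + 1 : ℕ) : ℝ) ^ 2) ^ 2)))
    (868 / 64 * Zr 2 * Zr 5 - 23 * 127 / 128 * Zr 7) := by
  refine double_nonneg (g := fun n => (16 * cpar 1 (n + 1) / ((n : ℝ) + 1)) *
      (3 / 4 * Zr 2 / ((n : ℝ) + 1) ^ 4 + (1 / 2 * Zr 2) / (4 * ((n : ℝ) + 1) ^ 4) -
        23 * 1 / (16 * ((n : ℝ) + 1) ^ 6))) (fun q => ?_) (fun n => ?_) ?_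
  · exact mul_nonneg (div_nonneg (mul_nonneg (by norm_num) (cpar_nonneg _ _)) (by positivity))
      (div_nonneg (cpar_nonneg _ _) (by positivity))
  · rcases Int.emod_two_eq_zero_or_one (n + 1) with h | h
    · have : cpar 1 ((n : ℤ) + 1) = 0 := by unfold cpar; rw [if_neg]; omega
      simp [this]
    · have hP : HasSum (fun p : ℕ => cpar 0 ((p : ℤ) + 1 - (n + 1 : ℕ)) / ((p : ℝ) + 1) ^ 2)
          (3 / 4 * Zr 2) := by
        refine hs_cg (Zr_odd 2 (by norm_num)) (fun p => ?_) (by ring)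
        have : cpar 0 ((p : ℤ) + 1 - (n + 1 : ℕ)) = cpar 1 (p + 1) := by
          unfold cpar
          have : ((p : ℤ) + 1 - (n + 1 : ℕ) + 0) % 2 = 0 ↔ ((p : ℤ) + 1 + 1) % 2 = 0 := by
            push_cast; omega
          simp only [this]
        rw [this]
      refine hs_cg ((F3_half 0 (n + 1) (by omega) _ _ Q_even hP).mul_left
        (16 * cpar 1 (n + 1) / ((n : ℝ) + 1))) (fun _ => rfl) ?_
      have c0 : cpar 0 0 = 1 := by norm_num [cpar]
      have c1 : cpar 0 ((n + 1 : ℕ) : ℤ) = 0 := by unfold cpar; rw [if_neg]; push_cast; omega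
      rw [c0, c1]; push_cast; ring
  · have h := ((Zr_odd 5 (by norm_num)).mul_left (14 * Zr 2)).sub
      ((Zr_odd 7 (by norm_num)).mul_left 23)
    refine hs_cg h (fun n => ?_) (by ring)
    field_simp
    ring

lemma S1r : HasSum (fun q : ℕ × ℕ => cpar 1 (q.1 + 1) / (((q.1 : ℝ) + 1) ^ 2 * ((q.2 : ℝ) + 1)
        * ((q.1 : ℝ) + q.2 + 2) * ((q.1 : ℝ) + 2 * q.2 + 3)))
    (3 / 8 * Zr 2 * Zr 3 - 31 / 64 * Zr 5) := by
  refine hs_cg (pair_sum D1 (fun x => ?_)) (fun q => ?_) rfl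
  · simp
  · obtain ⟨m, n⟩ := q
    simp only
    rw [cpar_congr 1 (((m + n + 1 : ℕ) : ℤ) + 1 - (n + 1 : ℕ)) (m + 1) (by push_cast; omega),
      cpar_congr 1 ((n : ℤ) + 1 - (m + n + 1 + 1 : ℕ)) (m + 1) (by push_cast; omega)]
    push_cast
    have e1 : ((m : ℝ) + n + 1 + 1) ^ 2 - ((n : ℝ) + 1) ^ 2 = (m + 1) * (m + 2 * n + 3) := by ring
    have e2 : ((n : ℝ) + 1) ^ 2 - ((m : ℝ) + n + 1 + 1) ^ 2 = -((m + 1) * (m + 2 * n + 3)) := by ring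
    rw [e1, e2]
    have : (m : ℝ) + n + 1 + 1 = m + n + 2 := by ring
    rw [this]
    field_simp
    ring

lemma S2r : HasSum (fun q : ℕ × ℕ => cpar 1 (q.1 + 1) / (((q.1 : ℝ) + 1) ^ 2 * ((q.2 : ℝ) + 1) ^ 2
        * ((q.1 : ℝ) + q.2 + 2) ^ 2 * ((q.1 : ℝ) + 2 * q.2 + 3)))
    (41 / 64 * Zr 2 * Zr 5 - 127 / 128 * Zr 7) := by
  refine hs_cg (pair_sum D2 (fun x => ?_)) (fun q => ?_) rfl
  · simp
  · obtain ⟨m, n⟩ := q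
    simp only
    rw [cpar_congr 1 (((m + n + 1 : ℕ) : ℤ) + 1 - (n + 1 : ℕ)) (m + 1) (by push_cast; omega),
      cpar_congr 1 ((n : ℤ) + 1 - (m + n + 1 + 1 : ℕ)) (m + 1) (by push_cast; omega)]
    push_cast
    have e1 : ((m : ℝ) + n + 1 + 1) ^ 2 - ((n : ℝ) + 1) ^ 2 = (m + 1) * (m + 2 * n + 3) := by ring
    have e2 : ((n : ℝ) + 1) ^ 2 - ((m : ℝ) + n + 1 + 1) ^ 2 = -((m + 1) * (m + 2 * n + 3)) := by ring
    rw [e1, e2]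
    have : (m : ℝ) + n + 1 + 1 = m + n + 2 := by ring
    rw [this]
    field_simp
    ring

lemma S3r : HasSum (fun q : ℕ × ℕ => cpar 1 (q.1 + 1) / (((q.1 : ℝ) + 1) * ((q.2 : ℝ) + 1) ^ 2
        * ((q.1 : ℝ) + q.2 + 2) ^ 2 * ((q.1 : ℝ) + 2 * q.2 + 3) ^ 2)
      + cpar 1 (q.1 + 1) / (((q.1 : ℝ) + 1) ^ 2 * ((q.2 : ℝ) + 1) ^ 2
        * ((q.1 : ℝ) + q.2 + 2) ^ 2 * ((q.1 : ℝ) + 2 * q.2 + 3)))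
    (868 / 64 * Zr 2 * Zr 5 - 23 * 127 / 128 * Zr 7) := by
  have h := pair_sum D3 (fun x => by simp)
  have hi : Function.Injective (fun q : ℕ × ℕ => (2 * q.2 + 1, q.1)) := by
    rintro ⟨a, b⟩ ⟨c, d⟩ h; simp at h ⊢; omega
  rw [← hi.hasSum_iff] at h
  · refine hs_cg h (fun q => ?_) rfl
    obtain ⟨m, n⟩ := q
    simp only [Function.comp]
    have k2 : cpar 0 (((2 * n + 1 + m + 1 : ℕ) : ℤ) + 1 - (m + 1 : ℕ)) = 1 := by
      unfold cpar; rw [if_pos]; push_cast; omega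
    have k3 : cpar 0 ((m : ℤ) + 1 - (2 * n + 1 + m + 1 + 1 : ℕ)) = 1 := by
      unfold cpar; rw [if_pos]; push_cast; omega
    have k4 : cpar 1 (((2 * n + 1 + m + 1 : ℕ) : ℤ) + 1) = cpar 1 (m + 1) :=
      cpar_congr _ _ _ (by push_cast; omega)
    rw [k2, k3, k4]
    push_cast
    have e0 : 2 * (n : ℝ) + 1 + m + 1 + 1 = m + 2 * n + 3 := by ring
    rw [e0]
    have e1 : ((m : ℝ) + 2 * n + 3) ^ 2 - ((m : ℝ) + 1) ^ 2 = 4 * ((n + 1) * (m + n + 2)) := by ring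
    have e2 : ((m : ℝ) + 1) ^ 2 - ((m : ℝ) + 2 * n + 3) ^ 2 = -(4 * ((n + 1) * (m + n + 2))) := by
      ring
    rw [e1, e2]
    field_simp
    ring
  · rintro ⟨a, m⟩ hx
    have ha : a % 2 = 0 := by
      by_contra hne
      exact hx ⟨(m, a / 2), by simp; omega⟩
    have k2 : cpar 0 (((a + m + 1 : ℕ) : ℤ) + 1 - (m + 1 : ℕ)) = 0 := by
      unfold cpar; rw [if_neg]; push_cast; omega
    have k3 : cpar 0 ((m : ℤ) + 1 - (a + m + 1 + 1 : ℕ)) = 0 := by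
      unfold cpar; rw [if_neg]; push_cast; omega
    simp only [k2, k3]
    simp

lemma S4r : HasSum (fun q : ℕ × ℕ => cpar 1 (q.1 + 1) / (((q.1 : ℝ) + 1) * ((q.2 : ℝ) + 1) ^ 2
        * ((q.1 : ℝ) + q.2 + 2) ^ 2 * ((q.1 : ℝ) + 2 * q.2 + 3) ^ 2))
    (827 / 64 * Zr 5 * Zr 2 - 1397 / 64 * Zr 7) :=
  hs_cg (S3r.sub S2r) (fun q => by ring) (by ring)


/-- ζ₂PSp2(2,1,1,1) = (3/8)ζ(2)ζ(3) − (31/64)ζ(5) and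
ζ₂PSp2(1,2,2,2) = (827/64)ζ(5)ζ(2) − (1397/64)ζ(7), where
ζ₂PSp2(s₁,s₂,s₃,s₄) = Σ_{m,n ≥ 1, m odd} m^{−s₁} n^{−s₂} (m+n)^{−s₃} (m+2n)^{−s₄}. -/
theorem zeta2_PSp2_odd_weight_values :
    ((∑' pr : ℕ × ℕ, (if (pr.1 + 1) % 2 = 1 then
      (1 : ℂ) / (((pr.1 : ℂ) + 1) ^ 2 * ((pr.2 : ℂ) + 1)
        * ((pr.1 : ℂ) + (pr.2 : ℂ) + 2)
        * ((pr.1 : ℂ) + 2 * (pr.2 : ℂ) + 3)) else 0))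
    = 3 / 8 * riemannZeta 2 * riemannZeta 3 - 31 / 64 * riemannZeta 5)
    ∧
    ((∑' pr : ℕ × ℕ, (if (pr.1 + 1) % 2 = 1 then
      (1 : ℂ) / (((pr.1 : ℂ) + 1) * ((pr.2 : ℂ) + 1) ^ 2
        * ((pr.1 : ℂ) + (pr.2 : ℂ) + 2) ^ 2
        * ((pr.1 : ℂ) + 2 * (pr.2 : ℂ) + 3) ^ 2) else 0))
    = 827 / 64 * riemannZeta 5 * riemannZeta 2 - 1397 / 64 * riemannZeta 7) := by
  have z2 := Zr_eq 2 (by norm_num)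
  have z3 := Zr_eq 3 (by norm_num)
  have z5 := Zr_eq 5 (by norm_num)
  have z7 := Zr_eq 7 (by norm_num)
  push_cast at z2 z3 z5 z7
  have hc : ∀ k : ℕ, ((cpar 1 ((k : ℤ) + 1) : ℝ) : ℂ) = if (k + 1) % 2 = 1 then 1 else 0 := by
    intro k
    unfold cpar
    have : ((k : ℤ) + 1 + 1) % 2 = 0 ↔ (k + 1) % 2 = 1 := by omega
    simp only [this]
    split_ifs <;> simp
  rw [z2, z3, z5, z7]
  constructor
  · have h := (Complex.hasSum_ofReal.2 S1r).tsum_eq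
    push_cast at h
    rw [← h]
    refine tsum_congr fun q => ?_
    rw [hc]
    split_ifs <;> simp
  · have h := (Complex.hasSum_ofReal.2 S4r).tsum_eq
    push_cast at h
    rw [← h]
    refine tsum_congr fun q => ?_
    rw [hc]
    split_ifs <;> simp
end
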